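/- arXiv:1407.2664 — 6 statements merged into one kernel-verified Lean document; each statement's English description precedes it below -/
import Mathlib

section
/- Let M be a d-dimensional Λ-module and let M' be a top-stable degeneration of M. Then the dimension vector of the radical layering of M is lexicographically less than or equal to that of M': (dim_K J^l M/J^{l+1} M)_{0 ≤ l ≤ L} ≤ (dim_K J^l M'/J^{l+1} M')_{0 ≤ l ≤ L} in the lexicographic order on (L+1)-tuples of non-negative integers. -/
open Module

/-- The Jacobson radical `J` of the ring `Λ` (intersection of the maximal left ideals). -/
noncomputable def jacRad (Λ : Type) [Ring Λ] : Ideal Λ := Ideal.jacobson ⊥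

/-- The submodule `J • M` of a `Λ`-module `M`. -/
noncomputable def jrad (Λ : Type) [Ring Λ] (M : Type) [AddCommGroup M] [Module Λ M] :
    Submodule Λ M :=
  Submodule.span Λ {x : M | ∃ a ∈ jacRad Λ, ∃ m : M, a • m = x}

/-- The underlying space of the `d`-dimensional representation `ρ : Λ →ₐ[K] M_d(K)`. -/
def RepSpace (K : Type) [Field K] (d : ℕ) {Λ : Type} [Ring Λ] [Algebra K Λ]
    (ρ : Λ →ₐ[K] Matrix (Fin d) (Fin d) K) : Type := Fin d → K

section RepSpace
variable (K : Type) [Field K] (d : ℕ) {Λ : Type} [Ring Λ] [Algebra K Λ]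
  (ρ : Λ →ₐ[K] Matrix (Fin d) (Fin d) K)

instance : AddCommGroup (RepSpace K d ρ) := inferInstanceAs (AddCommGroup (Fin d → K))
instance : Module K (RepSpace K d ρ) := inferInstanceAs (Module K (Fin d → K))

/-- The `Λ`-module structure on `K^d` induced by the representation `ρ`. -/
noncomputable instance RepSpace.moduleLambda : Module Λ (RepSpace K d ρ) :=
  Module.compHom (Fin d → K)
    ((Matrix.toLinAlgEquiv' :
        Matrix (Fin d) (Fin d) K ≃ₐ[K] Module.End K (Fin d → K)).toAlgHom.toRingHom.comp
      ρ.toRingHom)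

instance : IsScalarTower K Λ (RepSpace K d ρ) := by
  constructor
  intro k a v
  show (Matrix.toLinAlgEquiv'.toAlgHom.toRingHom.comp ρ.toRingHom (k • a)) v
      = k • ((Matrix.toLinAlgEquiv'.toAlgHom.toRingHom.comp ρ.toRingHom a) v)
  have h : (Matrix.toLinAlgEquiv'.toAlgHom.toRingHom.comp ρ.toRingHom (k • a))
      = k • (Matrix.toLinAlgEquiv'.toAlgHom.toRingHom.comp ρ.toRingHom a) := by
    simp [map_smul]
  rw [h]; rfl

end RepSpace

/-- `M_τ` is a degeneration of `M_ρ`: having fixed a `K`-basis `b` of `Λ` (which identifies the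
space of `K`-linear maps `Λ → M_d(K)` with an affine space with polynomial coordinate
functions indexed by `ι × Fin d × Fin d`), the point `τ` lies in the Zariski closure (the zero
locus of all polynomials vanishing on the orbit) of the conjugation orbit of `ρ` under
`GL_d(K)`. -/
def IsDegeneration {K Λ ι : Type} [Field K] [Ring Λ] [Algebra K Λ] [Fintype ι]
    (b : Basis ι K Λ) (d : ℕ) (ρ τ : Λ →ₐ[K] Matrix (Fin d) (Fin d) K) : Prop :=
  ∀ p : MvPolynomial (ι × Fin d × Fin d) K,
    (∀ g : GL (Fin d) K,
      MvPolynomial.eval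
        (fun x => ((g : Matrix (Fin d) (Fin d) K) * ρ (b x.1) *
            ((g⁻¹ : GL (Fin d) K) : Matrix (Fin d) (Fin d) K)) x.2.1 x.2.2) p = 0) →
    MvPolynomial.eval (fun x => τ (b x.1) x.2.1 x.2.2) p = 0


/-- The chain of submodules `J^l • M` of a `Λ`-module `M`. -/
noncomputable def radPow (Λ : Type) [Ring Λ] (M : Type) [AddCommGroup M] [Module Λ M] :
    ℕ → Submodule Λ M
  | 0 => ⊤
  | l + 1 => Submodule.span Λ {x : M | ∃ a ∈ jacRad Λ, ∃ m ∈ radPow Λ M l, a • m = x}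

/-- The `l`-th radical layer `J^l M / J^{l+1} M` of a `Λ`-module `M`. -/
noncomputable abbrev radLayer (Λ : Type) [Ring Λ] (M : Type) [AddCommGroup M] [Module Λ M]
    (l : ℕ) : Type :=
  ↥(radPow Λ M l) ⧸ (Submodule.comap (radPow Λ M l).subtype (radPow Λ M (l + 1)))

/-- `u ≤ v` in the lexicographic order on `(L+1)`-tuples of natural numbers
`(u 0, …, u L)`, `(v 0, …, v L)`. -/
def LexLe (L : ℕ) (u v : ℕ → ℕ) : Prop :=
  (∀ l ≤ L, u l = v l) ∨ ∃ j ≤ L, (∀ i < j, u i = v i) ∧ u j < v j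

lemma s8_smul_mem {Λ : Type} [Ring Λ] {M : Type} [AddCommGroup M] [Module Λ M] (l : ℕ) :
    ∀ a ∈ radPow Λ Λ l, ∀ m : M, a • m ∈ radPow Λ M l := by
  induction l with
  | zero => intro a _ m; exact Submodule.mem_top
  | succ l ih =>
    intro a ha m
    have : radPow Λ Λ (l+1) ≤ (radPow Λ M (l+1)).comap (LinearMap.toSpanSingleton Λ M m) := by
      refine Submodule.span_le.2 ?_
      rintro x ⟨c, hc, y, hy, rfl⟩
      show (c • y) • m ∈ radPow Λ M (l+1)
      rw [smul_assoc]
      exact Submodule.subset_span ⟨c, hc, y • m, ih y hy m, rfl⟩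
    exact this ha

lemma s8_le_span {Λ : Type} [Ring Λ] {M : Type} [AddCommGroup M] [Module Λ M] (l : ℕ) :
    radPow Λ M l ≤ Submodule.span Λ {x : M | ∃ a ∈ radPow Λ Λ l, ∃ m : M, a • m = x} := by
  induction l with
  | zero => intro x _; exact Submodule.subset_span ⟨1, Submodule.mem_top, x, one_smul _ _⟩
  | succ l ih =>
    refine Submodule.span_le.2 ?_
    rintro x ⟨c, hc, y, hy, rfl⟩
    have hy' := ih hy
    clear hy
    induction hy' using Submodule.span_induction generalizing c with
    | mem x hx =>
      obtain ⟨a, ha, m, rfl⟩ := hx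
      refine Submodule.subset_span ⟨c • a, Submodule.subset_span ⟨c, hc, a, ha, rfl⟩, m, ?_⟩
      rw [smul_assoc]
    | zero => rw [smul_zero]; exact Submodule.zero_mem _
    | add x y _ _ hx hy => rw [smul_add]; exact Submodule.add_mem _ (hx c hc) (hy c hc)
    | smul r x _ hx =>
      have h2 : c * r ∈ jacRad Λ := by
        have : (jacRad Λ).IsTwoSided := by unfold jacRad; infer_instance
        exact Ideal.mul_mem_right _ _ hc
      have := hx (c * r) h2
      rwa [mul_smul] at this

lemma s8_rep {Λ : Type} [Ring Λ] {M : Type} [AddCommGroup M] [Module Λ M] (l : ℕ)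
    (x : M) (hx : x ∈ radPow Λ M l) :
    ∃ (n : ℕ) (a : Fin n → Λ) (m : Fin n → M), (∀ k, a k ∈ radPow Λ Λ l) ∧
      ∑ k, a k • m k = x := by
  obtain ⟨n, f, g, h⟩ := Submodule.mem_span_set'.1 (s8_le_span l hx)
  choose a ha m hm using fun k => (g k).2
  refine ⟨n, fun k => f k • a k, m, fun k => Submodule.smul_mem _ _ (ha k), ?_⟩
  rw [← h]
  refine Finset.sum_congr rfl fun k _ => ?_
  rw [smul_assoc, hm]

lemma s8_anti {Λ : Type} [Ring Λ] {M : Type} [AddCommGroup M] [Module Λ M] (l : ℕ) :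
    radPow Λ M (l+1) ≤ radPow Λ M l := by
  refine Submodule.span_le.2 ?_
  rintro x ⟨c, hc, y, hy, rfl⟩
  exact Submodule.smul_mem _ _ hy

lemma s8_ex {K U V W : Type} [Field K] [AddCommGroup U] [AddCommGroup V] [AddCommGroup W]
    [Module K U] [Module K V] [Module K W] [FiniteDimensional K V] (i : U →ₗ[K] V)
    (f : V →ₗ[K] W) (hi : Function.Injective i) (hf : Function.Surjective f)
    (h : ∀ x, f x = 0 ↔ ∃ u, i u = x) : finrank K W + finrank K U = finrank K V := by
  have h0 := f.finrank_range_add_finrank_ker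
  have h1 : LinearMap.ker f = LinearMap.range i := by
    ext x; simp [h]
  rw [LinearMap.range_eq_top.2 hf, finrank_top, h1, LinearMap.finrank_range_of_inj hi] at h0
  exact h0

lemma s8_fdsub {K Λ : Type} [Field K] [Ring Λ] [Algebra K Λ] {M : Type} [AddCommGroup M]
    [Module Λ M] [Module K M] [IsScalarTower K Λ M] [FiniteDimensional K M]
    (p : Submodule Λ M) : FiniteDimensional K p :=
    FiniteDimensional.of_injective (p.subtype.restrictScalars K) p.injective_subtype

lemma s8_q1 {K Λ : Type} [Field K] [Ring Λ] [Algebra K Λ] {P : Type} [AddCommGroup P]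
    [Module Λ P] [Module K P] [IsScalarTower K Λ P] [FiniteDimensional K P]
    {Q : Type} [AddCommGroup Q]
    [Module Λ Q] [Module K Q] [IsScalarTower K Λ Q] (i : Q →ₗ[Λ] P) (hi : Function.Injective i)
    (q : Submodule Λ P) (hq : ∀ x, x ∈ q ↔ ∃ u, i u = x) :
    finrank K (P ⧸ q) + finrank K Q = finrank K P :=
  s8_ex (i.restrictScalars K) (q.mkQ.restrictScalars K) hi q.mkQ_surjective
    (fun x => (Submodule.Quotient.mk_eq_zero q).trans (hq x))

lemma s8_layer' {K Λ : Type} [Field K] [Ring Λ] [Algebra K Λ] {M : Type} [AddCommGroup M]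
    [Module Λ M] [Module K M] [IsScalarTower K Λ M] [FiniteDimensional K M]
    (p q : Submodule Λ M) (hpq : q ≤ p) :
    finrank K (p ⧸ q.comap p.subtype) + finrank K q = finrank K p := by
  have : FiniteDimensional K p := s8_fdsub p
  exact s8_q1 (Submodule.inclusion hpq) (Submodule.inclusion_injective hpq) _
    (fun x => ⟨fun h => ⟨⟨x.1, h⟩, rfl⟩, by rintro ⟨u, rfl⟩; exact u.2⟩)

lemma s8_layer {K Λ : Type} [Field K] [Ring Λ] [Algebra K Λ] {M : Type} [AddCommGroup M]
    [Module Λ M] [Module K M] [IsScalarTower K Λ M] [FiniteDimensional K M] (l : ℕ) :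
    finrank K (radLayer Λ M l) + finrank K (radPow Λ M (l+1)) = finrank K (radPow Λ M l) :=
  s8_layer' _ _ (s8_anti l)

lemma s8_smul_def {K Λ : Type} [Field K] [Ring Λ] [Algebra K Λ] (d : ℕ)
    (ρ : Λ →ₐ[K] Matrix (Fin d) (Fin d) K) (a : Λ) (m : RepSpace K d ρ) :
    (a • m : RepSpace K d ρ) = (ρ a).mulVec (m : Fin d → K) := rfl

instance s8_fd {K Λ : Type} [Field K] [Ring Λ] [Algebra K Λ] (d : ℕ)
    (ρ : Λ →ₐ[K] Matrix (Fin d) (Fin d) K) : FiniteDimensional K (RepSpace K d ρ) :=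
  inferInstanceAs (FiniteDimensional K (Fin d → K))

lemma s8_fr {K Λ : Type} [Field K] [Ring Λ] [Algebra K Λ] (d : ℕ)
    (ρ : Λ →ₐ[K] Matrix (Fin d) (Fin d) K) : finrank K (radPow Λ (RepSpace K d ρ) 0) = d := by
  have h : finrank K (((⊤ : Submodule Λ (RepSpace K d ρ)).restrictScalars K)) = d := by
    rw [Submodule.restrictScalars_top, finrank_top]
    exact Module.finrank_fin_fun K
  exact h

open Classical in
lemma s8_semi {K Λ ι : Type} [Field K] [Ring Λ] [Algebra K Λ]
    [Fintype ι] (b : Basis ι K Λ) (d : ℕ)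
    (ρ τ : Λ →ₐ[K] Matrix (Fin d) (Fin d) K)
    (hdeg : IsDegeneration b d ρ τ) (l : ℕ) :
    finrank K (radPow Λ (RepSpace K d τ) l) ≤ finrank K (radPow Λ (RepSpace K d ρ) l) := by
  set r := finrank K (radPow Λ (RepSpace K d τ) l) with hr
  let S : Submodule K (Fin d → K) := (radPow Λ (RepSpace K d τ) l).restrictScalars K
  have hS : finrank K S = r := rfl
  let B : Basis (Fin r) K S := Module.finBasisOfFinrankEq K S hS
  obtain ⟨f, hf⟩ := (S.subtype).exists_leftInverse_of_injective (Submodule.ker_subtype S)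
  let φ : (Fin d → K) →ₗ[K] (Fin r → K) := B.equivFun.toLinearMap ∘ₗ f
  have hφ : ∀ s, φ (B s) = Pi.single s 1 := by
    intro s
    have : f (B s) = B s := by simpa using LinearMap.congr_fun hf (B s)
    simp only [φ, LinearMap.comp_apply, this]
    ext t; simp [Finsupp.single_apply, Pi.single_apply, eq_comm]
  have hrep : ∀ s, ∃ (n : ℕ) (a : Fin n → Λ) (m : Fin n → Fin d → K),
      (∀ k, a k ∈ radPow Λ Λ l) ∧ ∑ k, (τ (a k)).mulVec (m k) = ((B s : S) : Fin d → K) :=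
    fun s => s8_rep (Λ := Λ) (M := RepSpace K d τ) l (B s).1 (B s).2
  choose n a m ha hm using hrep
  let A := LinearMap.toMatrix' φ
  let P : Matrix (Fin r) (Fin r) (MvPolynomial (ι × Fin d × Fin d) K) := fun t s =>
    ∑ i, MvPolynomial.C (A t i) * ∑ k, ∑ j,
      (∑ e, MvPolynomial.C (b.repr (a s k) e) * MvPolynomial.X (e, i, j)) *
        MvPolynomial.C ((m s k) j)
  have key : ∀ σ : Λ →ₗ[K] Matrix (Fin d) (Fin d) K,
      MvPolynomial.eval (fun x => σ (b x.1) x.2.1 x.2.2) P.det =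
      (Matrix.of fun t s => φ (∑ k, (σ (a s k)).mulVec (m s k)) t).det := by
    intro σ
    rw [RingHom.map_det]
    congr 1
    ext t s
    have h1 : ∀ x, φ x t = ∑ i, A t i * x i := fun x => by
      rw [← LinearMap.toMatrix'_mulVec φ x]; rfl
    rw [RingHom.mapMatrix_apply, Matrix.map_apply, Matrix.of_apply, h1]
    simp only [P, map_sum, map_mul,
      MvPolynomial.eval_C, MvPolynomial.eval_X, Finset.sum_apply]
    refine Finset.sum_congr rfl fun i _ => ?_
    congr 1
    refine Finset.sum_congr rfl fun k _ => ?_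
    refine Finset.sum_congr rfl fun j _ => ?_
    congr 1
    have h4 := congrArg (fun z => σ z i j) (b.sum_repr (a s k))
    simp only [map_sum, map_smul, Matrix.sum_apply, Matrix.smul_apply, smul_eq_mul] at h4
    exact h4
  have hτ : MvPolynomial.eval (fun x => τ (b x.1) x.2.1 x.2.2) P.det ≠ 0 := by
    have h := key τ.toLinearMap
    have h2 : (Matrix.of fun t s => φ (∑ k, (τ.toLinearMap (a s k)).mulVec
        (m s k)) t) = (1 : Matrix (Fin r) (Fin r) K) := by
      ext t s
      have h3 : (∑ k, (τ.toLinearMap (a s k)).mulVec (m s k)) = B s := hm s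
      rw [Matrix.of_apply, h3, hφ, Matrix.one_apply, Pi.single_apply]
    rw [h2, Matrix.det_one] at h
    exact h.trans_ne one_ne_zero
  have hex : ∃ g : GL (Fin d) K, MvPolynomial.eval
        (fun x => ((g : Matrix (Fin d) (Fin d) K) * ρ (b x.1) *
            ((g⁻¹ : GL (Fin d) K) : Matrix (Fin d) (Fin d) K)) x.2.1 x.2.2) P.det ≠ 0 := by
    by_contra! hc
    exact hτ (hdeg _ hc)
  obtain ⟨g, hg⟩ := hex
  let σ : Λ →ₗ[K] Matrix (Fin d) (Fin d) K :=
    (LinearMap.mulLeft K (g : Matrix (Fin d) (Fin d) K)) ∘ₗ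
    (LinearMap.mulRight K ((g⁻¹ : GL (Fin d) K) : Matrix (Fin d) (Fin d) K)) ∘ₗ ρ.toLinearMap
  have hσ : ∀ x, σ x = (g : Matrix (Fin d) (Fin d) K) * ρ x *
            ((g⁻¹ : GL (Fin d) K) : Matrix (Fin d) (Fin d) K) := fun x => by
    simp [σ, mul_assoc]
  have h := key σ
  simp only [hσ] at h
  rw [h] at hg
  -- the vectors in `J^l M`
  let y : Fin r → Fin d → K := fun s => ∑ k, (ρ (a s k)).mulVec
    (((g⁻¹ : GL (Fin d) K) : Matrix (Fin d) (Fin d) K).mulVec (m s k))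
  let T : Submodule K (Fin d → K) := (radPow Λ (RepSpace K d ρ) l).restrictScalars K
  have hy : ∀ s, y s ∈ T := by
    intro s
    refine Submodule.sum_mem T fun k _ => ?_
    exact s8_smul_mem (M := RepSpace K d ρ) l (a s k) (ha s k) _
  let ψ : (Fin d → K) →ₗ[K] (Fin r → K) := φ ∘ₗ Matrix.mulVecLin (g : Matrix (Fin d) (Fin d) K)
  have hψ : LinearIndependent K (fun s => ψ (y s)) := by
    have hli := Matrix.linearIndependent_cols_of_det_ne_zero hg
    have he : (fun s => ψ (y s)) = Matrix.col (Matrix.of fun t s => φ (∑ k,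
        ((g : Matrix (Fin d) (Fin d) K) * ρ (a s k) *
          ((g⁻¹ : GL (Fin d) K) : Matrix (Fin d) (Fin d) K)).mulVec (m s k)) t) := by
      ext s t
      have : (g : Matrix (Fin d) (Fin d) K).mulVec (y s) = ∑ k,
        ((g : Matrix (Fin d) (Fin d) K) * ρ (a s k) *
          ((g⁻¹ : GL (Fin d) K) : Matrix (Fin d) (Fin d) K)).mulVec (m s k) := by
        simp only [y, Matrix.mulVec_sum, Matrix.mulVec_mulVec, Matrix.mul_assoc]
      show φ ((g : Matrix (Fin d) (Fin d) K).mulVec (y s)) t = _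
      rw [this]
      rfl
    rw [he]
    exact hli
  have hyl : LinearIndependent K y := LinearIndependent.of_comp ψ hψ
  have hyl' : LinearIndependent K (fun s => (⟨y s, hy s⟩ : T)) :=
    LinearIndependent.of_comp T.subtype hyl
  have := hyl'.fintype_card_le_finrank
  rw [Fintype.card_fin] at this
  exact this

lemma s8_lex (L : ℕ) (u v D E : ℕ → ℕ) (hs : ∀ l, E l ≤ D l)
    (hu : ∀ l, u l + D (l+1) = D l) (hv : ∀ l, v l + E (l+1) = E l) (h0 : D 0 = E 0) :
    LexLe L u v := by
  by_cases h : ∀ l ≤ L, u l = v l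
  · exact Or.inl h
  · push Not at h
    classical
    obtain ⟨hj, hne⟩ := Nat.find_spec h
    have hlt : ∀ i < Nat.find h, u i = v i := by
      intro i hi
      by_contra hc
      exact Nat.find_min h hi ⟨by omega, hc⟩
    generalize Nat.find h = j at *
    refine Or.inr ⟨j, hj, hlt, ?_⟩
    have hD : ∀ i ≤ j, D i = E i := by
      intro i
      induction i with
      | zero => intro _; exact h0
      | succ i ih =>
        intro hi
        have := ih (by omega)
        have := hlt i (by omega)
        have := hu i
        have := hv i
        omega
    have := hD j le_rfl
    have := hu j
    have := hv j
    have := hs (j+1)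
    omega

/-- If `M'` is a top-stable degeneration of a `d`-dimensional module `M`,
then the dimension vector of the radical layering of `M` is lexicographically at most that of
`M'`. Here `L` is the least integer with `J^{L+1} = 0`. -/
theorem stmt8 {K Λ ι : Type} [Field K] [IsAlgClosed K] [Ring Λ] [Algebra K Λ]
    [FiniteDimensional K Λ] [Fintype ι] (b : Basis ι K Λ)
    -- `L` is the least integer with `J^{L+1} = 0` (powers of `J` measured as the
    -- submodules `J^l • Λ` of the regular module):
    (L : ℕ) (hL : radPow Λ Λ (L + 1) = ⊥) (hL' : radPow Λ Λ L ≠ ⊥)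
    (d : ℕ)
    (ρ τ : Λ →ₐ[K] Matrix (Fin d) (Fin d) K)
    -- `M' = M_τ` is a degeneration of `M = M_ρ`:
    (hdeg : IsDegeneration b d ρ τ)
    -- which is top-stable:
    (htop : Nonempty ((RepSpace K d τ ⧸ jrad Λ (RepSpace K d τ)) ≃ₗ[Λ]
      (RepSpace K d ρ ⧸ jrad Λ (RepSpace K d ρ)))) :
    -- then `(dim_K J^l M / J^{l+1} M)_{0 ≤ l ≤ L} ≤ (dim_K J^l M' / J^{l+1} M')_{0 ≤ l ≤ L}`
    -- lexicographically:
    LexLe L (fun l => finrank K (radLayer Λ (RepSpace K d ρ) l))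
      (fun l => finrank K (radLayer Λ (RepSpace K d τ) l)) := by
  have hs := s8_semi b d ρ τ hdeg
  have hu := fun l => s8_layer (K := K) (Λ := Λ) (M := RepSpace K d ρ) l
  have hv := fun l => s8_layer (K := K) (Λ := Λ) (M := RepSpace K d τ) l
  have h0 : finrank K (radPow Λ (RepSpace K d ρ) 0) = finrank K (radPow Λ (RepSpace K d τ) 0) := by
    rw [s8_fr, s8_fr]
  exact s8_lex L _ _ _ _ hs hu hv h0
end

section
/- Suppose that, up to isomorphism, Λ has only finitely many finite-dimensional uniserial left modules. Then any two finite-dimensional uniserial Λ-modules M and N with J^l M/J^{l+1} M ≅ J^l N/J^{l+1} N for all l ≥ 0 are isomorphic; in other words, for each sequence of simple modules there is at most one uniserial Λ-module having that sequence as its radical layering (equivalently, as its sequence of consecutive composition factors). -/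
open Module

/-- `M` is a finite-dimensional module: finite-dimensionality over `K` is measured via the
`K`-vector space structure obtained by restricting scalars along `algebraMap K Λ`. -/
def FinDimMod (K : Type) [Field K] (Λ : Type) [Ring Λ] [Algebra K Λ]
    (M : Type) [AddCommGroup M] [Module Λ M] : Prop :=
  letI : Module K M := Module.compHom M (algebraMap K Λ)
  FiniteDimensional K M

/-- A module is uniserial if its submodules are totally ordered by inclusion. -/
def IsUniserialMod (Λ : Type) [Ring Λ] (M : Type) [AddCommGroup M] [Module Λ M] : Prop :=
  ∀ A B : Submodule Λ M, A ≤ B ∨ B ≤ A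

section aux

lemma fd_iff {K Λ : Type} [Field K] [Ring Λ] [Algebra K Λ] [FiniteDimensional K Λ]
    (M : Type) [AddCommGroup M] [Module Λ M] : FinDimMod K Λ M ↔ Module.Finite Λ M := by
  unfold FinDimMod
  letI : Module K M := Module.compHom M (algebraMap K Λ)
  have : IsScalarTower K Λ M := ⟨fun k a m => by
    rw [Algebra.smul_def, mul_smul]; rfl⟩
  constructor
  · intro h
    change Module.Finite K M at h
    exact Module.Finite.of_restrictScalars_finite K Λ M
  · intro h
    exact Module.Finite.trans (R := K) Λ M

variable {Λ : Type} [Ring Λ]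

lemma uni_surj {M N : Type} [AddCommGroup M] [Module Λ M] [AddCommGroup N] [Module Λ N]
    (f : M →ₗ[Λ] N) (hf : Function.Surjective f) (h : IsUniserialMod Λ M) :
    IsUniserialMod Λ N := by
  intro A B
  have key : ∀ A B : Submodule Λ N, A.comap f ≤ B.comap f → A ≤ B := by
    intro A B hAB x hx
    obtain ⟨y, rfl⟩ := hf x
    exact hAB hx
  exact (h (A.comap f) (B.comap f)).imp (key _ _) (key _ _)

lemma uni_inj {M N : Type} [AddCommGroup M] [Module Λ M] [AddCommGroup N] [Module Λ N]
    (f : M →ₗ[Λ] N) (hf : Function.Injective f) (h : IsUniserialMod Λ N) :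
    IsUniserialMod Λ M := by
  intro A B
  exact (h (A.map f) (B.map f)).imp (Submodule.map_le_map_iff_of_injective hf _ _).1
    (Submodule.map_le_map_iff_of_injective hf _ _).1

lemma uni_quot (I : Submodule Λ Λ) :
    IsUniserialMod Λ (Λ ⧸ I) ↔ ∀ A B : Submodule Λ Λ, I ≤ A → I ≤ B → A ≤ B ∨ B ≤ A := by
  constructor
  · intro h A B hA hB
    have key : ∀ A B : Submodule Λ Λ, I ≤ B → A.map I.mkQ ≤ B.map I.mkQ → A ≤ B := by
      intro A B hB hAB x hx
      obtain ⟨y, hy, hxy⟩ := hAB (Submodule.mem_map_of_mem hx)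
      have : x - y ∈ I := (Submodule.Quotient.eq I).1 hxy.symm
      simpa using B.add_mem (hB this) hy
    exact (h (A.map I.mkQ) (B.map I.mkQ)).imp (key _ _ hB) (key _ _ hA)
  · intro h A B
    have key : ∀ A B : Submodule Λ (Λ ⧸ I), A.comap I.mkQ ≤ B.comap I.mkQ → A ≤ B := by
      intro A B hAB x hx
      obtain ⟨y, rfl⟩ := I.mkQ_surjective x
      exact hAB hx
    have h0 : ∀ A : Submodule Λ (Λ ⧸ I), I ≤ A.comap I.mkQ := by
      intro A x hx
      have : I.mkQ x = 0 := by simpa using hx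
      simp only [Submodule.mem_comap, this, zero_mem]
    exact (h _ _ (h0 A) (h0 B)).imp (key _ _) (key _ _)

variable {T : Type} [AddCommGroup T] [Module Λ T] {L : Submodule Λ Λ}

/-- kernel of `g : L → T` as a left ideal -/
def kg (g : L →ₗ[Λ] T) : Submodule Λ Λ := (LinearMap.ker g).map L.subtype

lemma mem_kg (g : L →ₗ[Λ] T) (x : Λ) : x ∈ kg g ↔ ∃ h : x ∈ L, g ⟨x, h⟩ = 0 := by
  simp [kg]

lemma kg_le (g : L →ₗ[Λ] T) : kg g ≤ L := fun x hx => ((mem_kg g x).1 hx).1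

/-- every left ideal above `kg g` is `kg g` or contains `L` -/
def Ess (g : L →ₗ[Λ] T) : Prop := ∀ A : Submodule Λ Λ, kg g ≤ A → L ≤ A ∨ A = kg g

lemma surj_of_ne [IsSimpleModule Λ T] (g : L →ₗ[Λ] T) (hg : g ≠ 0) : Function.Surjective g :=
  LinearMap.surjective_of_ne_zero hg

lemma ess_of_not_ext [IsSimpleModule Λ T] (g : L →ₗ[Λ] T) (L' : Submodule Λ Λ) (hLL : L ≤ L')
    (hL' : ∀ A : Submodule Λ Λ, L < A → L' ≤ A)
    (hg : ¬ ∃ h : L' →ₗ[Λ] T, ∀ x : L, h ⟨x, hLL x.2⟩ = g x) : Ess g := by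
  intro A hA
  rcases eq_bot_or_eq_top ((A.comap L.subtype).map g) with h | h
  · right
    have hAL : ∀ x (hx : x ∈ L), x ∈ A → g ⟨x, hx⟩ = 0 := by
      intro x hx hxA
      have : g ⟨x, hx⟩ ∈ (A.comap L.subtype).map g :=
        Submodule.mem_map_of_mem (by simpa using hxA)
      rw [h] at this
      simpa using this
    by_contra hne
    have hlt : L < A ⊔ L := by
      refine lt_of_le_of_ne le_sup_right ?_
      intro heq
      have hAle : A ≤ L := by rw [heq]; exact le_sup_left
      exact hne (le_antisymm (fun x hx => (mem_kg g x).2 ⟨hAle hx, hAL x _ hx⟩) hA)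
    have hle := hL' _ hlt
    have hex : ∀ x : L', ∃ l : L, (x : Λ) - l ∈ A := by
      intro x
      obtain ⟨a, ha, l, hl, hal⟩ := Submodule.mem_sup.1 (hle x.2)
      exact ⟨⟨l, hl⟩, by simpa [← hal] using ha⟩
    choose f hf using hex
    have huniq : ∀ (x : L') (l : L), (x : Λ) - l ∈ A → g (f x) = g l := by
      intro x l hl
      rw [← sub_eq_zero, ← map_sub]
      apply hAL
      have := A.sub_mem hl (hf x)
      simpa using this
    refine hg ⟨{ toFun := fun x => g (f x), map_add' := ?_, map_smul' := ?_ }, ?_⟩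
    · intro x y
      rw [← map_add]
      apply huniq
      have := A.add_mem (hf x) (hf y)
      convert this using 1
      simp only [Submodule.coe_add]
      abel
    · intro c x
      simp only [RingHom.id_apply]
      rw [← map_smul]
      apply huniq
      have := A.smul_mem c (hf x)
      convert this using 1
      simp [mul_sub]
    · intro x
      exact huniq _ _ (by simp)
  · left
    intro x hx
    have : g ⟨x, hx⟩ ∈ (A.comap L.subtype).map g := by rw [h]; trivial
    obtain ⟨y, hy, hxy⟩ := this
    have h2 : x - y ∈ kg g := by
      refine (mem_kg g _).2 ⟨L.sub_mem hx y.2, ?_⟩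
      have h3 : (⟨x - y, L.sub_mem hx y.2⟩ : L) = ⟨x, hx⟩ - y := rfl
      rw [h3, map_sub, hxy, sub_self]
    have := A.add_mem (hA h2) hy
    simpa using this

lemma uni_of_ess (g : L →ₗ[Λ] T) (hg : Ess g)
    (hch : ∀ A B : Submodule Λ Λ, L ≤ A → L ≤ B → A ≤ B ∨ B ≤ A) :
    IsUniserialMod Λ (Λ ⧸ kg g) := by
  rw [uni_quot]
  intro A B hA hB
  rcases hg A hA with h | h
  · rcases hg B hB with h' | h'
    · exact hch A B h h'
    · right; rw [h']; exact hA
  · left; rw [h]; exact hB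

lemma not_ext_of_uni [IsSimpleModule Λ T] (g : L →ₗ[Λ] T) (hg0 : g ≠ 0)
    (hu : IsUniserialMod Λ (Λ ⧸ kg g)) (L' : Submodule Λ Λ) (hLL : L < L') :
    ¬ ∃ h : L' →ₗ[Λ] T, ∀ x : L, h ⟨x, hLL.le x.2⟩ = g x := by
  rintro ⟨h, hh⟩
  rw [uni_quot] at hu
  have hgh : kg g ≤ kg h := by
    intro x hx
    obtain ⟨hx, h0⟩ := (mem_kg g _).1 hx
    refine (mem_kg h _).2 ⟨hLL.le hx, ?_⟩
    rw [← h0, ← hh]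
  rcases hu L (kg h) (kg_le g) hgh with h1 | h1
  · apply hg0
    ext x
    obtain ⟨hx, h0⟩ := (mem_kg h _).1 (h1 x.2)
    rw [← hh, h0]; rfl
  · apply hLL.not_ge
    intro x hx
    obtain ⟨l, hl⟩ := surj_of_ne g hg0 (h ⟨x, hx⟩)
    have : x - l ∈ kg h := by
      refine (mem_kg h _).2 ⟨L'.sub_mem hx (hLL.le l.2), ?_⟩
      have h3 : (⟨x - l, L'.sub_mem hx (hLL.le l.2)⟩ : L') = ⟨x, hx⟩ - ⟨l, hLL.le l.2⟩ := rfl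
      rw [h3, map_sub, hh, hl, sub_self]
    simpa using L.add_mem (h1 this) l.2

/-- the relation `g = c . g' . r_a` -/
def GRel (g g' : L →ₗ[Λ] T) : Prop := ∃ a : Λ, ∀ x : L, ∃ h : (x : Λ) * a ∈ L, g x = g' ⟨x * a, h⟩

lemma rel_of_iso {K : Type} [Field K] [IsAlgClosed K] [Algebra K Λ] [Module K T]
    [IsScalarTower K Λ T] [FiniteDimensional K T] [IsSimpleModule Λ T]
    (g g' : L →ₗ[Λ] T) (hg : Ess g) (hg0 : g ≠ 0) (hg'0 : g' ≠ 0)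
    (φ : (Λ ⧸ kg g) ≃ₗ[Λ] (Λ ⧸ kg g')) : GRel g g' := by
  obtain ⟨a, ha⟩ := (kg g').mkQ_surjective (φ ((kg g).mkQ 1))
  have hφ : ∀ x : Λ, φ ((kg g).mkQ x) = (kg g').mkQ (x * a) := by
    intro x
    have : x = x • (1 : Λ) := by simp
    rw [this, map_smul, map_smul, ← ha, ← map_smul]; simp
  have hker : ∀ x : Λ, x ∈ kg g ↔ x * a ∈ kg g' := by
    intro x
    have h1 : (kg g).mkQ x = 0 ↔ x ∈ kg g := by simp
    have h2 : (kg g').mkQ (x * a) = 0 ↔ x * a ∈ kg g' := by simp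
    rw [← h1, ← h2, ← hφ]
    simp
  have hLA : L ≤ L.comap (LinearMap.toSpanSingleton Λ Λ a) := by
    have hkc : kg g ≤ L.comap (LinearMap.toSpanSingleton Λ Λ a) := by
      intro x hx
      have := kg_le _ ((hker x).1 hx)
      simpa using this
    rcases hg (L.comap (LinearMap.toSpanSingleton Λ Λ a)) hkc with h | h
    · exact h
    · exfalso
      apply hg'0
      ext y
      obtain ⟨z, hz⟩ := φ.surjective ((kg g').mkQ y)
      obtain ⟨x, rfl⟩ := (kg g).mkQ_surjective z
      rw [hφ] at hz
      have hz' : x * a - y ∈ kg g' := (Submodule.Quotient.eq _).1 hz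
      have hxa : x * a ∈ L := by
        have := L.add_mem (kg_le _ hz') y.2
        simpa using this
      have hx : x ∈ kg g := by
        rw [← h]; simpa using hxa
      have : (y : Λ) ∈ kg g' := by
        have := (kg g').sub_mem ((hker x).1 hx) hz'
        simpa using this
      obtain ⟨_, h0⟩ := (mem_kg _ _).1 this
      exact h0
  have hL : ∀ x : L, (x : Λ) * a ∈ L := fun x => by simpa using hLA x.2
  let r : L →ₗ[Λ] L := (LinearMap.toSpanSingleton Λ Λ a).restrict hLA
  have hr : ∀ x : L, r x = ⟨x * a, hL x⟩ := fun x => rfl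
  have hk : LinearMap.ker (g' ∘ₗ r) = LinearMap.ker g := by
    ext x
    have h1 := hker x
    rw [mem_kg, mem_kg] at h1
    simp only [LinearMap.mem_ker, LinearMap.comp_apply, hr]
    constructor
    · intro h; obtain ⟨_, h⟩ := h1.2 ⟨hL x, h⟩; exact h
    · intro h; obtain ⟨_, h⟩ := h1.1 ⟨x.2, h⟩; exact h
  have hg1 : g' ∘ₗ r ≠ 0 := by
    intro h0
    apply hg0
    rw [h0, LinearMap.ker_zero] at hk
    exact LinearMap.ker_eq_top.1 hk.symm
  have hs := surj_of_ne _ hg1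
  let α : T →ₗ[Λ] T := ((LinearMap.ker (g' ∘ₗ r)).liftQ g hk.le) ∘ₗ
    ((g' ∘ₗ r).quotKerEquivOfSurjective hs).symm.toLinearMap
  have hα : ∀ x, α (g' (r x)) = g x := by
    intro x
    have : ((g' ∘ₗ r).quotKerEquivOfSurjective hs).symm (g' (r x))
        = (LinearMap.ker (g' ∘ₗ r)).mkQ x := by
      rw [LinearEquiv.symm_apply_eq]; rfl
    simp only [α, LinearMap.comp_apply, LinearEquiv.coe_coe, this]
    rfl
  obtain ⟨c, hc⟩ := (IsSimpleModule.algebraMap_end_bijective_of_isAlgClosed (A := Λ) (V := T) K).2 α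
  have hmem : ∀ x : L, (x : Λ) * (c • a) ∈ L := by
    intro x
    have : (x : Λ) * (c • a) = (algebraMap K Λ c) • ((x : Λ) * a) := by
      rw [Algebra.mul_smul_comm, Algebra.smul_def]; rfl
    rw [this]
    exact L.smul_mem _ (hL x)
  refine ⟨c • a, fun x => ⟨hmem x, ?_⟩⟩
  have h3 : (⟨(x : Λ) * (c • a), hmem x⟩ : L) = (algebraMap K Λ c) • r x := by
    apply Subtype.ext
    simp only [hr, Submodule.coe_smul, smul_eq_mul]
    rw [Algebra.mul_smul_comm, Algebra.smul_def]
  rw [h3, map_smul, algebraMap_smul, ← hα, ← hc]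
  rfl

lemma finrank_kg {K : Type} [Field K] [Algebra K Λ] [FiniteDimensional K Λ] [Module K T]
    [IsScalarTower K Λ T] [FiniteDimensional K T] [IsSimpleModule Λ T]
    (g : L →ₗ[Λ] T) (hg0 : g ≠ 0) :
    Module.finrank K (Λ ⧸ kg g) + Module.finrank K L = Module.finrank K T + Module.finrank K Λ := by
  have : FiniteDimensional K L :=
    inferInstanceAs (FiniteDimensional K (L.restrictScalars K))
  have h1 := LinearMap.finrank_range_add_finrank_ker (g.restrictScalars K)
  have h0 : LinearMap.range (g.restrictScalars K) = ⊤ :=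
    LinearMap.range_eq_top.2 (surj_of_ne g hg0)
  rw [h0, finrank_top] at h1
  have h2 := Submodule.finrank_quotient_add_finrank ((kg g).restrictScalars K)
  have h3 : Module.finrank K (LinearMap.ker (g.restrictScalars K)) =
      Module.finrank K ((kg g).restrictScalars K) := by
    have e : LinearMap.ker g ≃ₗ[Λ] kg g :=
      Submodule.equivMapOfInjective L.subtype L.injective_subtype (LinearMap.ker g)
    exact (e.restrictScalars K).finrank_eq
  have h4 : Module.finrank K (Λ ⧸ (kg g).restrictScalars K) = Module.finrank K (Λ ⧸ kg g) := rfl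
  omega

lemma iso_of_rel {K : Type} [Field K] [Algebra K Λ] [FiniteDimensional K Λ] [Module K T]
    [IsScalarTower K Λ T] [FiniteDimensional K T] [IsSimpleModule Λ T]
    (g g' : L →ₗ[Λ] T) (hg : Ess g) (hg0 : g ≠ 0) (h : GRel g g') :
    Nonempty ((Λ ⧸ kg g) ≃ₗ[Λ] (Λ ⧸ kg g')) := by
  obtain ⟨a, ha⟩ := h
  have hg'0 : g' ≠ 0 := by
    rintro rfl
    apply hg0
    ext x
    obtain ⟨_, h⟩ := ha x
    simpa using h
  have hle : kg g ≤ (kg g').comap (LinearMap.toSpanSingleton Λ Λ a) := by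
    intro x hx
    obtain ⟨hx, h0⟩ := (mem_kg _ _).1 hx
    obtain ⟨h1, h2⟩ := ha ⟨x, hx⟩
    rw [h0] at h2
    simp only [Submodule.mem_comap, LinearMap.toSpanSingleton_apply, smul_eq_mul]
    exact (mem_kg _ _).2 ⟨h1, h2.symm⟩
  let φ : (Λ ⧸ kg g) →ₗ[Λ] (Λ ⧸ kg g') := (kg g).mapQ (kg g') (LinearMap.toSpanSingleton Λ Λ a) hle
  have hinj : Function.Injective φ := by
    rw [← LinearMap.ker_eq_bot, Submodule.ker_mapQ]
    rcases hg _ hle with h | h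
    · exfalso
      apply hg0
      ext x
      have := h x.2
      simp only [Submodule.mem_comap, LinearMap.toSpanSingleton_apply, smul_eq_mul] at this
      obtain ⟨_, h0⟩ := (mem_kg _ _).1 this
      obtain ⟨h1, h2⟩ := ha x
      rw [h2, h0]; rfl
    · rw [h]; exact Submodule.mkQ_map_self _
  have hd : Module.finrank K (Λ ⧸ kg g) = Module.finrank K (Λ ⧸ kg g') := by
    have h1 := finrank_kg (K := K) g hg0
    have h2 := finrank_kg (K := K) g' hg'0
    omega
  have hs : Function.Surjective φ :=
    (LinearMap.injective_iff_surjective_of_finrank_eq_finrank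
      (f := φ.restrictScalars K) hd).1 hinj
  exact ⟨LinearEquiv.ofBijective φ ⟨hinj, hs⟩⟩

/-- presentation of an extension -/
lemma exists_g [IsSimpleModule Λ T] {X N : Type} [AddCommGroup X] [Module Λ X] [AddCommGroup N]
    [Module Λ N] [Nontrivial X]
    (x0 : X) (hx0 : LinearMap.range (LinearMap.toSpanSingleton Λ X x0) = ⊤)
    (j : T →ₗ[Λ] N) (q : N →ₗ[Λ] X) (hj : Function.Injective j) (hq : Function.Surjective q)
    (hjq : LinearMap.range j = LinearMap.ker q) (hu : IsUniserialMod Λ N) :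
    ∃ g : LinearMap.ker (LinearMap.toSpanSingleton Λ X x0) →ₗ[Λ] T, g ≠ 0 ∧
      Nonempty (N ≃ₗ[Λ] (Λ ⧸ kg g)) := by
  obtain ⟨n0, hn0⟩ := hq x0
  have hqs : ∀ a : Λ, q (a • n0) = a • x0 := fun a => by rw [map_smul, hn0]
  have hs : LinearMap.range j ≤ LinearMap.range (LinearMap.toSpanSingleton Λ N n0) := by
    rcases hu (LinearMap.range j) (LinearMap.range (LinearMap.toSpanSingleton Λ N n0)) with h | h
    · exact h
    · exfalso
      have h1 : n0 ∈ LinearMap.range j := h ⟨1, by simp⟩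
      rw [hjq, LinearMap.mem_ker, hn0] at h1
      subst h1
      rw [LinearMap.toSpanSingleton_zero, LinearMap.range_zero] at hx0
      exact bot_ne_top hx0
  have hsurj : Function.Surjective (LinearMap.toSpanSingleton Λ N n0) := by
    intro n
    have : q n ∈ LinearMap.range (LinearMap.toSpanSingleton Λ X x0) := by rw [hx0]; trivial
    obtain ⟨a, ha⟩ := this
    have h2 : n - a • n0 ∈ LinearMap.range j := by
      rw [hjq, LinearMap.mem_ker, map_sub, hqs, ← ha]; simp
    obtain ⟨b, hb⟩ := hs h2
    refine ⟨b + a, ?_⟩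
    rw [map_add, hb]; simp
  have hex : ∀ l : LinearMap.ker (LinearMap.toSpanSingleton Λ X x0), ∃ t : T, j t = (l : Λ) • n0 := by
    intro l
    have : (l : Λ) • n0 ∈ LinearMap.range j := by
      rw [hjq, LinearMap.mem_ker, hqs]
      exact l.2
    exact this
  choose f hf using hex
  let g : LinearMap.ker (LinearMap.toSpanSingleton Λ X x0) →ₗ[Λ] T :=
    { toFun := f
      map_add' := fun x y => hj (by rw [map_add, hf, hf, hf]; simp [add_smul])
      map_smul' := fun c x => hj (by simp [hf, mul_smul]) }
  have hgf : ∀ l, j (g l) = (l : Λ) • n0 := hf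
  refine ⟨g, ?_, ?_⟩
  · intro h0
    have := IsSimpleModule.nontrivial Λ T
    obtain ⟨t, ht⟩ := exists_ne (0 : T)
    obtain ⟨a, ha⟩ := hsurj (j t)
    have haL : a ∈ LinearMap.ker (LinearMap.toSpanSingleton Λ X x0) := by
      have : q (j t) = 0 := by
        rw [← LinearMap.mem_ker, ← hjq]; exact ⟨t, rfl⟩
      rw [← ha] at this
      simpa [hn0] using this
    have h1 := hgf ⟨a, haL⟩
    rw [h0] at h1
    simp only [LinearMap.toSpanSingleton_apply] at ha
    rw [ha] at h1
    apply ht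
    apply hj
    rw [← h1]; simp
  · have hk : LinearMap.ker (LinearMap.toSpanSingleton Λ N n0) = kg g := by
      ext a
      rw [mem_kg]
      constructor
      · intro h
        have h' : a • n0 = 0 := by simpa using h
        refine ⟨?_, ?_⟩
        · have := hqs a
          rw [h', map_zero] at this
          simpa using this.symm
        · apply hj; rw [hgf]; simpa using h'
      · rintro ⟨h, h0⟩
        have := hgf ⟨a, h⟩
        rw [h0, map_zero] at this
        simpa using this.symm
    exact ⟨((LinearMap.quotKerEquivOfSurjective _ hsurj).symm).trans
      (Submodule.quotEquivOfEq _ _ hk)⟩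

lemma cyclic_of_uni {M : Type} [AddCommGroup M] [Module Λ M] [Module.Finite Λ M] [Nontrivial M]
    (hu : IsUniserialMod Λ M) :
    ∃ m : M, LinearMap.range (LinearMap.toSpanSingleton Λ M m) = ⊤ := by
  obtain ⟨C, hC, -⟩ := (eq_top_or_exists_le_coatom (⊥ : Submodule Λ M)).resolve_left bot_ne_top
  obtain ⟨m, hm⟩ : ∃ m, m ∉ C := by
    by_contra! h
    exact hC.1 (eq_top_iff.2 fun x _ => h x)
  refine ⟨m, ?_⟩
  have hmm : m ∈ LinearMap.range (LinearMap.toSpanSingleton Λ M m) := ⟨1, by simp⟩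
  rcases hu C (LinearMap.range (LinearMap.toSpanSingleton Λ M m)) with h | h
  · exact hC.2 _ (lt_of_le_of_ne h fun h' => hm (h' ▸ hmm))
  · exact absurd (h hmm) hm

end aux

section aux2

variable {Λ : Type} [Ring Λ] {T : Type} [AddCommGroup T] [Module Λ T] {L : Submodule Λ Λ}

/-- maps that extend to `L'` -/
def extSub (K : Type) [Field K] [Algebra K Λ] [Module K T] [IsScalarTower K Λ T]
    (L' : Submodule Λ Λ) (hLL : L ≤ L') : Submodule K (L →ₗ[Λ] T) where
  carrier := {g | ∃ h : L' →ₗ[Λ] T, ∀ x : L, h ⟨x, hLL x.2⟩ = g x}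
  zero_mem' := ⟨0, fun _ => rfl⟩
  add_mem' := by
    rintro a b ⟨h, hh⟩ ⟨h', hh'⟩
    exact ⟨h + h', fun x => by simp [hh, hh']⟩
  smul_mem' := by
    rintro c a ⟨h, hh⟩
    exact ⟨c • h, fun x => by simp [hh]⟩

/-- maps of the form `g' . r_a` -/
def relSub (K : Type) [Field K] [Algebra K Λ] [Module K T] [IsScalarTower K Λ T]
    (g' : L →ₗ[Λ] T) : Submodule K (L →ₗ[Λ] T) where
  carrier := {g | GRel g g'}
  zero_mem' := by
    refine ⟨0, fun x => ⟨by simp, ?_⟩⟩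
    have h : (⟨(x : Λ) * 0, by simp⟩ : L) = 0 := Subtype.ext (mul_zero _)
    rw [h, map_zero]; rfl
  add_mem' := by
    rintro g1 g2 ⟨a, ha⟩ ⟨b, hb⟩
    refine ⟨a + b, fun x => ?_⟩
    obtain ⟨h1, h2⟩ := ha x
    obtain ⟨h3, h4⟩ := hb x
    refine ⟨by rw [mul_add]; exact L.add_mem h1 h3, ?_⟩
    rw [LinearMap.add_apply, h2, h4, ← map_add]
    congr 1
    exact Subtype.ext (mul_add _ _ _).symm
  smul_mem' := by
    rintro c g ⟨a, ha⟩
    refine ⟨c • a, fun x => ?_⟩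
    obtain ⟨h1, h2⟩ := ha x
    have h3 : (x : Λ) * (c • a) = (algebraMap K Λ c) • ((x : Λ) * a) := by
      rw [Algebra.mul_smul_comm, Algebra.smul_def]; rfl
    refine ⟨by rw [h3]; exact L.smul_mem _ h1, ?_⟩
    rw [LinearMap.smul_apply, h2, ← algebraMap_smul Λ c, ← map_smul]
    congr 1
    exact Subtype.ext h3.symm

lemma key {K : Type} [Field K] [IsAlgClosed K] [Algebra K Λ] [FiniteDimensional K Λ]
    (hfin : ∃ (n : ℕ) (rep : Fin n → ModuleCat Λ),
      ∀ (U : Type) (_ : AddCommGroup U) (_ : Module Λ U),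
        FinDimMod K Λ U → IsUniserialMod Λ U →
        ∃ i : Fin n, Nonempty (U ≃ₗ[Λ] (rep i : Type)))
    [IsSimpleModule Λ T]
    {X M N : Type} [AddCommGroup X] [Module Λ X] [AddCommGroup M] [Module Λ M]
    [AddCommGroup N] [Module Λ N] [Module.Finite Λ M]
    (hMu : IsUniserialMod Λ M) (hNu : IsUniserialMod Λ N)
    (i : T →ₗ[Λ] M) (p : M →ₗ[Λ] X) (hi : Function.Injective i) (hp : Function.Surjective p)
    (hip : LinearMap.range i = LinearMap.ker p)
    (j : T →ₗ[Λ] N) (q : N →ₗ[Λ] X) (hj : Function.Injective j) (hq : Function.Surjective q)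
    (hjq : LinearMap.range j = LinearMap.ker q) : Nonempty (M ≃ₗ[Λ] N) := by
  rcases subsingleton_or_nontrivial X with hX | hX
  · have h1 : Function.Surjective i := fun m => by
      have : m ∈ LinearMap.range i := by rw [hip]; exact Subsingleton.elim _ _
      exact this
    have h2 : Function.Surjective j := fun m => by
      have : m ∈ LinearMap.range j := by rw [hjq]; exact Subsingleton.elim _ _
      exact this
    exact ⟨(LinearEquiv.ofBijective i ⟨hi, h1⟩).symm.trans (LinearEquiv.ofBijective j ⟨hj, h2⟩)⟩
  let _ : Module K T := Module.compHom T (algebraMap K Λ)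
  have _ : IsScalarTower K Λ T := ⟨fun k a m => by
    rw [Algebra.smul_def, mul_smul]; rfl⟩
  have : Module.Finite Λ T := inferInstance
  have : FiniteDimensional K T := Module.Finite.trans (R := K) Λ T
  have : IsArtinianRing Λ := IsArtinianRing.of_finite K Λ
  have : Module.Finite Λ X := Module.Finite.of_surjective p hp
  obtain ⟨x0, hx0⟩ := cyclic_of_uni (uni_surj p hp hMu)
  obtain ⟨gM, hgM0, ⟨eM⟩⟩ := exists_g x0 hx0 i p hi hp hip hMu
  obtain ⟨gN, hgN0, ⟨eN⟩⟩ := exists_g x0 hx0 j q hj hq hjq hNu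
  have huM := uni_surj eM.toLinearMap eM.surjective hMu
  have huN := uni_surj eN.toLinearMap eN.surjective hNu
  generalize hL : LinearMap.ker (LinearMap.toSpanSingleton Λ X x0) = L at *
  have hch : ∀ A B : Submodule Λ Λ, L ≤ A → L ≤ B → A ≤ B ∨ B ≤ A := by
    intro A B hA hB
    exact (uni_quot _).1 huM A B ((kg_le _).trans hA) ((kg_le _).trans hB)
  have hLtop : L < ⊤ := by
    rw [lt_top_iff_ne_top, ← hL]
    intro h
    rw [LinearMap.ker_eq_top] at h
    rw [h, LinearMap.range_zero] at hx0
    exact bot_ne_top hx0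
  obtain ⟨L', hLL', hmin⟩ : ∃ L' : Submodule Λ Λ, L < L' ∧ ∀ A, L < A → L' ≤ A := by
    obtain ⟨L', h1, h2⟩ := WellFounded.has_min (wellFounded_lt (α := Submodule Λ Λ))
      {A | L < A} ⟨⊤, hLtop⟩
    refine ⟨L', h1, fun A hA => ?_⟩
    rcases hch L' A (le_of_lt h1) hA.le with h | h
    · exact h
    · by_contra hcon
      exact h2 A hA (lt_of_le_not_ge h hcon)
  let H : Submodule K (L →ₗ[Λ] T) := extSub K L' hLL'.le
  have hess : ∀ g : L →ₗ[Λ] T, g ∉ H → Ess g := fun g hg =>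
    ess_of_not_ext g L' hLL'.le hmin hg
  have hne : ∀ g : L →ₗ[Λ] T, g ∉ H → g ≠ 0 := fun g hg h0 => hg (h0 ▸ H.zero_mem)
  have hMH : gM ∉ H := not_ext_of_uni gM hgM0 huM L' hLL'
  have hNH : gN ∉ H := not_ext_of_uni gN hgN0 huN L' hLL'
  obtain ⟨n, rep, hrep⟩ := hfin
  have hall : ∀ g : L →ₗ[Λ] T, g ∉ H → ∃ k, Nonempty ((Λ ⧸ kg g) ≃ₗ[Λ] (rep k : Type)) :=
    fun g hg => hrep _ _ _ ((fd_iff _).2 inferInstance) (uni_of_ess g (hess g hg) hch)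
  have hS : ∀ k, ∃ g' : L →ₗ[Λ] T, ∀ g, g ∉ H →
      Nonempty ((Λ ⧸ kg g) ≃ₗ[Λ] (rep k : Type)) → GRel g g' := by
    intro k
    by_cases h : ∃ g' : L →ₗ[Λ] T, g' ∉ H ∧ Nonempty ((Λ ⧸ kg g') ≃ₗ[Λ] (rep k : Type))
    · obtain ⟨g', hg', ⟨e'⟩⟩ := h
      refine ⟨g', fun g hg ⟨e⟩ => ?_⟩
      exact rel_of_iso (K := K) g g' (hess g hg) (hne g hg) (hne g' hg') (e.trans e'.symm)
    · exact ⟨0, fun g hg he => absurd ⟨g, hg, he⟩ h⟩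
  choose s hs using hS
  have : Infinite K := IsAlgClosed.instInfinite
  have htop : ∃ k, relSub K (s k) = ⊤ := by
    by_contra! hcon
    let F : Finset (Submodule K (L →ₗ[Λ] T)) :=
      (((Set.finite_range fun k => relSub K (s k)).insert H)).toFinset
    have hF : ⊤ ∉ F := by
      simp only [F, Set.Finite.mem_toFinset, Set.mem_insert_iff, Set.mem_range, not_or, not_exists]
      refine ⟨fun h => hMH (h ▸ Submodule.mem_top), hcon⟩
    apply Subspace.biUnion_ne_univ_of_top_notMem hF
    rw [Set.eq_univ_iff_forall]
    intro g
    simp only [F, Set.Finite.mem_toFinset, Set.mem_insert_iff, Set.mem_range, Set.mem_iUnion,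
      SetLike.mem_coe, exists_prop]
    by_cases hg : g ∈ H
    · exact ⟨H, Or.inl rfl, hg⟩
    · obtain ⟨k, hk⟩ := hall g hg
      exact ⟨_, Or.inr ⟨k, rfl⟩, hs k g hg hk⟩
  obtain ⟨k, hk⟩ := htop
  have hrM : GRel gM (s k) := by
    have : gM ∈ relSub K (s k) := hk ▸ Submodule.mem_top
    exact this
  have hrN : GRel gN (s k) := by
    have : gN ∈ relSub K (s k) := hk ▸ Submodule.mem_top
    exact this
  obtain ⟨f1⟩ := iso_of_rel (K := K) gM (s k) (hess _ hMH) hgM0 hrM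
  obtain ⟨f2⟩ := iso_of_rel (K := K) gN (s k) (hess _ hNH) hgN0 hrN
  exact ⟨eM.trans (f1.trans (f2.symm.trans eN.symm))⟩

lemma radPow_anti (M : Type) [AddCommGroup M] [Module Λ M] (l : ℕ) :
    radPow Λ M (l + 1) ≤ radPow Λ M l := by
  rw [radPow, Submodule.span_le]
  rintro x ⟨a, -, m, hm, rfl⟩
  exact Submodule.smul_mem _ _ hm

lemma jacRad_eq : jacRad Λ = Ring.jacobson Λ := by
  rw [jacRad, Ideal.jacobson_bot]

lemma radPow_le (M : Type) [AddCommGroup M] [Module Λ M] (l : ℕ) :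
    radPow Λ M l ≤ (Ring.jacobson Λ) ^ l • (⊤ : Submodule Λ M) := by
  induction l with
  | zero => rw [Submodule.pow_zero, Ideal.one_eq_top]; simp
  | succ l ih =>
    rw [radPow, Submodule.span_le]
    rintro x ⟨a, ha, m, hm, rfl⟩
    rw [jacRad_eq] at ha
    rw [Ideal.IsTwoSided.pow_succ, Submodule.mul_smul]
    exact Submodule.smul_mem_smul ha (ih hm)

lemma radPow_zero [IsArtinianRing Λ] : ∃ n, ∀ (M : Type) [AddCommGroup M] [Module Λ M],
    radPow Λ M n = ⊥ := by
  obtain ⟨n, hn⟩ := IsSemiprimaryRing.isNilpotent (R := Λ)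
  refine ⟨n, fun M _ _ => ?_⟩
  have := radPow_le (Λ := Λ) M n
  rw [hn] at this
  simpa using this

lemma layer_simple [IsArtinianRing Λ] (M : Type) [AddCommGroup M] [Module Λ M]
    [Module.Finite Λ M] (hu : IsUniserialMod Λ M) (l : ℕ) (hn : Nontrivial (radLayer Λ M l)) :
    IsSimpleModule Λ (radLayer Λ M l) := by
  have hu' : IsUniserialMod Λ (radLayer Λ M l) :=
    uni_surj (Submodule.mkQ _) (Submodule.mkQ_surjective _)
      (uni_inj (radPow Λ M l).subtype (Submodule.injective_subtype _) hu)
  have hann : ∀ a ∈ Ring.jacobson Λ, ∀ x : radLayer Λ M l, a • x = 0 := by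
    intro a ha x
    obtain ⟨y, rfl⟩ := Submodule.mkQ_surjective _ x
    rw [← map_smul, Submodule.mkQ_apply, Submodule.Quotient.mk_eq_zero, Submodule.mem_comap]
    rw [radPow]
    exact Submodule.subset_span ⟨a, by rwa [jacRad_eq], y, y.2, rfl⟩
  have hss : IsSemisimpleModule Λ (radLayer Λ M l) := by
    have h : Module.IsTorsionBySet Λ (radLayer Λ M l) (Ring.jacobson Λ) :=
      fun x a => hann a.1 a.2 x
    let _ := h.module
    exact (h.semilinearMap.isSemisimpleModule_iff_of_bijective Function.bijective_id).2
      inferInstance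
  refine { exists_pair_ne := ⟨⊥, ⊤, bot_ne_top⟩, eq_bot_or_eq_top := fun A => ?_ }
  obtain ⟨B, hB⟩ := exists_isCompl A
  rcases hu' A B with h | h
  · left
    exact le_bot_iff.1 (hB.disjoint le_rfl h)
  · right
    exact top_le_iff.1 (hB.codisjoint le_rfl h)

lemma layer_seq (M : Type) [AddCommGroup M] [Module Λ M] (l : ℕ) :
    ∃ (i : radLayer Λ M l →ₗ[Λ] (M ⧸ radPow Λ M (l + 1)))
      (p : (M ⧸ radPow Λ M (l + 1)) →ₗ[Λ] (M ⧸ radPow Λ M l)),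
      Function.Injective i ∧ Function.Surjective p ∧ LinearMap.range i = LinearMap.ker p := by
  refine ⟨Submodule.mapQ _ _ (radPow Λ M l).subtype le_rfl,
    Submodule.factor (radPow_anti M l), ?_, Submodule.factor_surjective _, ?_⟩
  · rw [← LinearMap.ker_eq_bot, Submodule.ker_mapQ]
    exact Submodule.mkQ_map_self _
  · ext x
    obtain ⟨y, rfl⟩ := Submodule.mkQ_surjective _ x
    constructor
    · rintro ⟨z, hz⟩
      obtain ⟨w, rfl⟩ := Submodule.mkQ_surjective _ z
      rw [← hz]
      simp
    · intro h
      have : y ∈ radPow Λ M l := by simpa using h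
      exact ⟨Submodule.mkQ _ ⟨y, this⟩, by simp⟩

end aux2

/-- Suppose that, up to isomorphism, `Λ` has only finitely many
finite-dimensional uniserial left modules.  Then any two finite-dimensional uniserial
`Λ`-modules with isomorphic radical layerings are isomorphic. -/
theorem stmt9 {K Λ : Type} [Field K] [IsAlgClosed K] [Ring Λ] [Algebra K Λ]
    [FiniteDimensional K Λ]
    -- up to isomorphism there are only finitely many finite-dimensional uniserial modules:
    (hfin : ∃ (n : ℕ) (rep : Fin n → ModuleCat Λ),
      ∀ (U : Type) (_ : AddCommGroup U) (_ : Module Λ U),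
        FinDimMod K Λ U → IsUniserialMod Λ U →
        ∃ i : Fin n, Nonempty (U ≃ₗ[Λ] (rep i : Type)))
    (M : Type) [AddCommGroup M] [Module Λ M]
    (N : Type) [AddCommGroup N] [Module Λ N]
    (hM : FinDimMod K Λ M) (hN : FinDimMod K Λ N)
    (hMu : IsUniserialMod Λ M) (hNu : IsUniserialMod Λ N)
    -- `M` and `N` have isomorphic radical layerings:
    (hlayers : ∀ l : ℕ, Nonempty (radLayer Λ M l ≃ₗ[Λ] radLayer Λ N l)) :
    Nonempty (M ≃ₗ[Λ] N) := by
  have : IsArtinianRing Λ := IsArtinianRing.of_finite K Λ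
  have : Module.Finite Λ M := (fd_iff M).1 hM
  have : Module.Finite Λ N := (fd_iff N).1 hN
  have main : ∀ l, Nonempty ((M ⧸ radPow Λ M l) ≃ₗ[Λ] (N ⧸ radPow Λ N l)) := by
    intro l
    induction l with
    | zero =>
      have h1 : Subsingleton (M ⧸ radPow Λ M 0) :=
        Submodule.Quotient.subsingleton_iff.2 rfl
      have h2 : Subsingleton (N ⧸ radPow Λ N 0) :=
        Submodule.Quotient.subsingleton_iff.2 rfl
      exact ⟨0⟩
    | succ l ih =>
      obtain ⟨e⟩ := ih
      obtain ⟨t⟩ := hlayers l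
      obtain ⟨i, p, hi, hp, hip⟩ := layer_seq (Λ := Λ) M l
      obtain ⟨j, q, hj, hq, hjq⟩ := layer_seq (Λ := Λ) N l
      rcases subsingleton_or_nontrivial (radLayer Λ M l) with hT | hT
      · have hT' : Subsingleton (radLayer Λ N l) := t.symm.toEquiv.subsingleton
        have hp' : Function.Injective p := by
          rw [← LinearMap.ker_eq_bot, ← hip, LinearMap.range_eq_bot]
          exact Subsingleton.elim _ _
        have hq' : Function.Injective q := by
          rw [← LinearMap.ker_eq_bot, ← hjq, LinearMap.range_eq_bot]
          exact Subsingleton.elim _ _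
        exact ⟨(LinearEquiv.ofBijective p ⟨hp', hp⟩).trans
          (e.trans (LinearEquiv.ofBijective q ⟨hq', hq⟩).symm)⟩
      · have := layer_simple M hMu l hT
        refine key hfin (uni_surj (Submodule.mkQ _) (Submodule.mkQ_surjective _) hMu)
          (uni_surj (Submodule.mkQ _) (Submodule.mkQ_surjective _) hNu) i p hi hp hip
          (j ∘ₗ t.toLinearMap) (e.symm.toLinearMap ∘ₗ q) (hj.comp t.injective)
          (e.symm.surjective.comp hq) ?_
        rw [LinearEquiv.ker_comp, ← hjq, LinearMap.range_comp, LinearEquiv.range,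
          Submodule.map_top]
  obtain ⟨n, hn⟩ := radPow_zero (Λ := Λ)
  obtain ⟨e⟩ := main n
  exact ⟨(Submodule.quotEquivOfEqBot _ (hn M)).symm.trans
    (e.trans (Submodule.quotEquivOfEqBot _ (hn N)))⟩
end

section
/- Let e ∈ Λ be a primitive idempotent. Then the following are equivalent: (i) every left ideal C of Λ contained in Λe satisfies C = CΛ ∩ Λe; (ii) every left ideal C of Λ contained in Λe is invariant under all Λ-endomorphisms of the left module Λe; (iii) for every λ ∈ Je and every ω ∈ eJe, the product λω belongs to Λλ. In particular these conditions hold whenever (Je)^2 = 0. -/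
open Module

theorem aux_mem {Λ : Type} [Ring Λ] {e : Λ} (he : IsIdempotentElem e) {x : Λ} :
    x ∈ (Ideal.span {e} : Ideal Λ) ↔ x * e = x := by
  rw [Ideal.mem_span_singleton']
  constructor
  · rintro ⟨a, rfl⟩
    rw [mul_assoc, he.eq]
  · intro h
    exact ⟨x, h⟩

/-- right multiplication by `a` on `Λe`. -/
def rmul {Λ : Type} [Ring Λ] (e a : Λ) (he : IsIdempotentElem e) (ha : a * e = a) :
    ↥(Ideal.span {e} : Ideal Λ) →ₗ[Λ] ↥(Ideal.span {e} : Ideal Λ) where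
  toFun x := ⟨x.1 * a, (aux_mem he).2 (by rw [mul_assoc, ha])⟩
  map_add' x y := by ext; simp [add_mul]
  map_smul' r x := by ext; simp [mul_assoc]

theorem rmul_pow {Λ : Type} [Ring Λ] (e a : Λ) (he : IsIdempotentElem e) (ha : a * e = a)
    (n : ℕ) (x : ↥(Ideal.span {e} : Ideal Λ)) :
    (((rmul e a he ha) ^ n) x).1 = x.1 * a ^ n := by
  induction n generalizing x with
  | zero => simp
  | succ n ih =>
    rw [pow_succ, Module.End.mul_apply, ih, pow_succ', ← mul_assoc]
    rfl

theorem aux_dich {Λ : Type} [Ring Λ] [IsArtinianRing Λ] [IsNoetherianRing Λ]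
    (e : Λ) (he : IsIdempotentElem e)
    (hprim : ∀ A B : Ideal Λ, A ⊔ B = Ideal.span {e} → A ⊓ B = ⊥ → A = ⊥ ∨ B = ⊥)
    (a : Λ) (ha : a * e = a) (ha' : e * a = a) :
    IsNilpotent a ∨ ∃ z, z * a = e := by
  set f := rmul e a he ha with hf
  obtain ⟨n, hn⟩ := Filter.eventually_atTop.1 f.eventually_isCompl_ker_pow_range_pow
  have h := hn (n + 1) (by omega)
  let P := (Ideal.span {e} : Ideal Λ)
  have hinj : Function.Injective P.subtype := P.injective_subtype
  have eP : e ∈ P := (aux_mem he).2 he.eq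
  rcases hprim ((LinearMap.ker (f ^ (n + 1))).map P.subtype)
    ((LinearMap.range (f ^ (n + 1))).map P.subtype) (by
      rw [← Submodule.map_sup, h.sup_eq_top, Submodule.map_top, Submodule.range_subtype]) (by
      rw [← Submodule.map_inf _ hinj, h.inf_eq_bot, Submodule.map_bot]) with h1 | h1
  · right
    have h2 : LinearMap.ker (f ^ (n + 1)) = ⊥ :=
      Submodule.map_injective_of_injective hinj (by rw [h1, Submodule.map_bot])
    have h3 : LinearMap.range (f ^ (n + 1)) = ⊤ := by
      have := h.sup_eq_top
      rwa [h2, bot_sup_eq] at this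
    obtain ⟨z, hz⟩ := LinearMap.range_eq_top.1 h3 ⟨e, eP⟩
    have := congrArg Subtype.val hz
    rw [rmul_pow] at this
    exact ⟨z.1 * a ^ n, by rw [mul_assoc, ← pow_succ]; exact this⟩
  · left
    have h2 : LinearMap.range (f ^ (n + 1)) = ⊥ :=
      Submodule.map_injective_of_injective hinj (by rw [h1, Submodule.map_bot])
    have h3 := LinearMap.range_eq_bot.1 h2
    have := congrArg Subtype.val (LinearMap.congr_fun h3 ⟨e, eP⟩)
    rw [rmul_pow] at this
    refine ⟨n + 1, ?_⟩
    rw [pow_succ', ← mul_assoc] at this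
    simp only [ha'] at this
    rw [pow_succ']
    exact this

theorem aux_nil {Λ : Type} [Ring Λ] (e c : Λ) (hc : c * e = c)
    (h : ∀ y, IsNilpotent (e * y * c)) : c ∈ jacRad Λ := by
  unfold jacRad
  rw [Ideal.mem_jacobson_iff]
  intro y
  obtain ⟨m, hm⟩ := h y
  have key : ∀ m : ℕ, (y * c) ^ (m + 1) = y * c * (e * y * c) ^ m := by
    intro m
    induction m with
    | zero => simp
    | succ m ih =>
      rw [pow_succ', ih, pow_succ' (e * y * c)]
      calc y * c * (y * c * (e * y * c) ^ m) = y * (c * e) * (y * c * (e * y * c) ^ m) := by rw [hc]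
        _ = _ := by simp only [mul_assoc]
  have hnil : IsNilpotent (y * c) := ⟨m + 1, by rw [key, hm, mul_zero]⟩
  obtain ⟨u, hu⟩ := hnil.isUnit_add_one
  refine ⟨↑u⁻¹, ?_⟩
  have : (↑u⁻¹ : Λ) * (y * c + 1) = 1 := by rw [← hu]; simp
  rw [Ideal.mem_bot, mul_assoc, ← this]
  noncomm_ring

theorem aux_B {Λ : Type} [Ring Λ] [IsArtinianRing Λ] [IsNoetherianRing Λ]
    (e : Λ) (he : IsIdempotentElem e)
    (hprim : ∀ A B : Ideal Λ, A ⊔ B = Ideal.span {e} → A ⊓ B = ⊥ → A = ⊥ ∨ B = ⊥)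
    (c : Λ) (hc : c * e = c) (hJ : c ∉ jacRad Λ) : ∃ z, z * c = e := by
  by_contra hz
  push Not at hz
  apply hJ
  refine aux_nil e c hc fun y => ?_
  rcases aux_dich e he hprim (e * y * c) (by rw [mul_assoc, hc])
    (by rw [← mul_assoc, ← mul_assoc, he.eq]) with h | ⟨z, h⟩
  · exact h
  · exact absurd (by rw [mul_assoc]; exact h) (hz (z * (e * y)))

theorem aux_A {K Λ : Type} [Field K] [IsAlgClosed K] [Ring Λ] [Algebra K Λ]
    [FiniteDimensional K Λ] [IsArtinianRing Λ] [IsNoetherianRing Λ]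
    (e : Λ) (he : IsIdempotentElem e)
    (hprim : Ideal.span {e} ≠ ⊥ ∧ ∀ A B : Ideal Λ, A ⊔ B = Ideal.span {e} → A ⊓ B = ⊥ →
      A = ⊥ ∨ B = ⊥) (a : Λ) (ha : a * e = a) (ha' : e * a = a) :
    ∃ k : K, a - k • e ∈ jacRad Λ := by
  have : Nontrivial ↥(Ideal.span {e} : Ideal Λ) :=
    Submodule.nontrivial_iff_ne_bot.2 hprim.1
  have : FiniteDimensional K ↥(Ideal.span {e} : Ideal Λ) :=
    inferInstanceAs (FiniteDimensional K ↥((Ideal.span {e} : Ideal Λ).restrictScalars K))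
  obtain ⟨k, hk⟩ := Module.End.exists_eigenvalue ((rmul e a he ha).restrictScalars K)
  obtain ⟨v, hv⟩ := hk.exists_hasEigenvector
  have h1 : v.1 * a = k • v.1 := congrArg Subtype.val hv.apply_eq_smul
  have h2 : v.1 * e = v.1 := (aux_mem he).1 v.2
  refine ⟨k, ?_⟩
  have hb : (a - k • e) * e = a - k • e := by rw [sub_mul, smul_mul_assoc, ha, he.eq]
  by_contra hJ
  obtain ⟨z, hz⟩ := aux_B e he hprim.2 _ hb hJ
  have hs : Function.Surjective (rmul e _ he hb) := by
    intro x
    refine ⟨⟨x.1 * z * e, (aux_mem he).2 (by rw [mul_assoc, he.eq])⟩, ?_⟩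
    have hb' : e * (a - k • e) = a - k • e := by rw [mul_sub, mul_smul_comm, ha', he.eq]
    ext
    change x.1 * z * e * (a - k • e) = x.1
    rw [mul_assoc _ e, hb', mul_assoc, hz]
    exact (aux_mem he).1 x.2
  have hi := IsNoetherian.injective_of_surjective_endomorphism _ hs
  apply hv.2
  apply hi
  ext
  simp [rmul, mul_sub, h1, h2]

theorem aux_main {K Λ : Type} [Field K] [IsAlgClosed K] [Ring Λ] [Algebra K Λ]
    [FiniteDimensional K Λ] [IsArtinianRing Λ] [IsNoetherianRing Λ]
    (e : Λ) (he : IsIdempotentElem e)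
    (hprim : Ideal.span {e} ≠ ⊥ ∧ ∀ A B : Ideal Λ, A ⊔ B = Ideal.span {e} → A ⊓ B = ⊥ →
      A = ⊥ ∨ B = ⊥)
    (h3 : ∀ lam : Λ, lam ∈ jacRad Λ → lam * e = lam →
        ∀ om : Λ, om ∈ jacRad Λ → e * om * e = om →
          lam * om ∈ Ideal.span {lam})
    (C : Ideal Λ) (hC : C ≤ Ideal.span {e}) (c : Λ) (hc : c ∈ C)
    (a : Λ) (ha : a * e = a) (ha' : e * a = a) : c * a ∈ C := by
  have hce : c * e = c := (aux_mem he).1 (hC hc)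
  by_cases hJ : c ∈ jacRad Λ
  · obtain ⟨k, hk⟩ := aux_A (K := K) e he hprim a ha ha'
    have h := h3 c hJ hce _ hk (by
      rw [mul_sub, sub_mul, ha', ha, mul_smul_comm, smul_mul_assoc, he.eq, he.eq])
    have h' : c * (a - k • e) ∈ C := (Ideal.span_singleton_le_iff_mem (I := C)).2 hc h
    have h4 : c * a = c * (a - k • e) + (algebraMap K Λ k) * c := by
      rw [mul_sub, mul_smul_comm, hce, Algebra.smul_def]
      abel
    rw [h4]
    exact C.add_mem h' (C.mul_mem_left _ hc)
  · obtain ⟨z, hz⟩ := aux_B e he hprim.2 c hce hJ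
    have : c * a = c * a * z * c := by rw [mul_assoc _ z, hz, mul_assoc, ha]
    rw [this]
    exact C.mul_mem_left _ hc

/-- Let `e ∈ Λ` be a primitive idempotent.  Then the following are
equivalent: (i) every left ideal `C ⊆ Λe` satisfies `C = CΛ ∩ Λe`; (ii) every left ideal
`C ⊆ Λe` is invariant under all `Λ`-endomorphisms of the left module `Λe`; (iii) for every
`λ ∈ Je` and every `ω ∈ eJe` one has `λω ∈ Λλ`.  In particular these conditions hold
whenever `(Je)² = 0`. -/
theorem stmt10 {K Λ : Type} [Field K] [IsAlgClosed K] [Ring Λ] [Algebra K Λ]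
    [FiniteDimensional K Λ]
    (e : Λ) (he : IsIdempotentElem e)
    -- `e` is primitive: the left module `Λe` is indecomposable:
    (hprim : Ideal.span {e} ≠ ⊥ ∧ ∀ A B : Ideal Λ, A ⊔ B = Ideal.span {e} → A ⊓ B = ⊥ →
      A = ⊥ ∨ B = ⊥) :
    -- (i) ↔ (iii):
    (((∀ C : Ideal Λ, C ≤ Ideal.span {e} →
        C = Submodule.span Λ {x : Λ | ∃ c ∈ C, ∃ l : Λ, c * l = x} ⊓ Ideal.span {e})
      ↔
      (∀ lam : Λ, lam ∈ jacRad Λ → lam * e = lam →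
        ∀ om : Λ, om ∈ jacRad Λ → e * om * e = om →
          lam * om ∈ Ideal.span {lam})))
    ∧
    -- (ii) ↔ (iii):
    (((∀ C : Ideal Λ, C ≤ Ideal.span {e} →
        ∀ f : ↥(Ideal.span {e} : Ideal Λ) →ₗ[Λ] ↥(Ideal.span {e} : Ideal Λ),
          Submodule.map f (Submodule.comap (Ideal.span {e} : Ideal Λ).subtype C) ≤
            Submodule.comap (Ideal.span {e} : Ideal Λ).subtype C)
      ↔
      (∀ lam : Λ, lam ∈ jacRad Λ → lam * e = lam →
        ∀ om : Λ, om ∈ jacRad Λ → e * om * e = om →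
          lam * om ∈ Ideal.span {lam})))
    ∧
    -- in particular, `(Je)² = 0` implies these conditions:
    ((∀ x y : Λ, x ∈ jacRad Λ → x * e = x → y ∈ jacRad Λ → y * e = y → x * y = 0) →
      (∀ lam : Λ, lam ∈ jacRad Λ → lam * e = lam →
        ∀ om : Λ, om ∈ jacRad Λ → e * om * e = om →
          lam * om ∈ Ideal.span {lam})) := by
  have : IsArtinianRing Λ := IsArtinianRing.of_finite K Λ
  have : IsNoetherianRing Λ := IsNoetherianRing.of_finite K Λ
  refine ⟨⟨?_, ?_⟩, ⟨?_, ?_⟩, ?_⟩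
  · intro h lam _ hl om _ hom
    have homr : om * e = om := by rw [← hom, mul_assoc, he.eq]
    rw [h (Ideal.span {lam})
      ((Ideal.span_singleton_le_iff_mem (I := Ideal.span {e})).2 ((aux_mem he).2 hl))]
    exact ⟨Submodule.subset_span ⟨lam, Ideal.mem_span_singleton_self lam, om, rfl⟩,
      (aux_mem he).2 (by rw [mul_assoc, homr])⟩
  · intro h3 C hC
    apply le_antisymm
    · intro c hc
      exact ⟨Submodule.subset_span ⟨c, hc, 1, mul_one c⟩, hC hc⟩
    · rintro x ⟨hx, hxe⟩
      have hxe' : x * e = x := (aux_mem he).1 hxe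
      rw [← hxe']
      clear hxe hxe'
      change x ∈ Submodule.span Λ {x : Λ | ∃ c ∈ C, ∃ l : Λ, c * l = x} at hx
      induction hx using Submodule.span_induction with
      | mem x hx =>
        obtain ⟨c, hc, l, rfl⟩ := hx
        have hce : c * e = c := (aux_mem he).1 (hC hc)
        have := aux_main (K := K) e he hprim h3 C hC c hc (e * l * e) (by rw [mul_assoc, he.eq])
          (by rw [← mul_assoc, ← mul_assoc, he.eq])
        rwa [← mul_assoc, ← mul_assoc, hce] at this
      | zero => rw [zero_mul]; exact C.zero_mem
      | add x y _ _ hx hy => rw [add_mul]; exact C.add_mem hx hy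
      | smul r x _ hx => rw [smul_eq_mul, mul_assoc]; exact C.mul_mem_left _ hx
  · intro h lam _ hl om _ hom
    have homr : om * e = om := by rw [← hom, mul_assoc, he.eq]
    exact h (Ideal.span {lam})
      ((Ideal.span_singleton_le_iff_mem (I := Ideal.span {e})).2 ((aux_mem he).2 hl))
      (rmul e om he homr)
      (Submodule.mem_map_of_mem (r := ⟨lam, (aux_mem he).2 hl⟩) (Ideal.mem_span_singleton_self lam))
  · intro h3 C hC f
    rintro _ ⟨c, hc, rfl⟩
    change c.1 ∈ C at hc
    change (f c).1 ∈ C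
    have eP : e ∈ (Ideal.span {e} : Ideal Λ) := (aux_mem he).2 he.eq
    have key : ∀ x : ↥(Ideal.span {e} : Ideal Λ), (f x).1 = x.1 * (f ⟨e, eP⟩).1 := by
      intro x
      have hx : x = x.1 • (⟨e, eP⟩ : ↥(Ideal.span {e} : Ideal Λ)) :=
        Subtype.ext ((aux_mem he).1 x.2).symm
      conv_lhs => rw [hx, map_smul]
      rfl
    rw [key]
    exact aux_main (K := K) e he hprim h3 C hC c.1 hc _ ((aux_mem he).1 (f ⟨e, eP⟩).2)
      (key ⟨e, eP⟩).symm
  · intro h lam hlJ hl om hoJ hom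
    have homr : om * e = om := by rw [← hom, mul_assoc, he.eq]
    rw [h lam om hlJ hl hoJ homr]
    exact Submodule.zero_mem _
end

section
/- Let P be a finite-dimensional projective Λ-module, C ⊆ JP a Λ-submodule, and ρ : {f ∈ Aut_Λ(P) : f(C) ⊆ C} → Aut_Λ(P/C) the homomorphism sending f to the induced automorphism of P/C. Then the image under ρ of the subgroup {f ∈ Aut_Λ(P) : f(C) ⊆ C and (f − id_P)(P) ⊆ JP} is exactly the subgroup {h ∈ Aut_Λ(P/C) : (h − id)(P/C) ⊆ J·(P/C)} of Aut_Λ(P/C). -/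
open Module

theorem jrad_le_coatom (Λ : Type) [Ring Λ] (M : Type) [AddCommGroup M] [Module Λ M]
    (N : Submodule Λ M) (hN : IsCoatom N) : jrad Λ M ≤ N := by
  refine Submodule.span_le.2 ?_
  rintro _ ⟨a, ha, m, rfl⟩
  have h1 : Ring.jacobson Λ • (⊤ : Submodule Λ M) ≤ N :=
    (Ring.jacobson_smul_top_le Λ M).trans (sInf_le hN)
  apply h1
  refine Submodule.smul_mem_smul ?_ trivial
  rw [← Ideal.jacobson_bot]
  exact ha

theorem jrad_map_mk (Λ : Type) [Ring Λ] (M : Type) [AddCommGroup M] [Module Λ M]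
    (C : Submodule Λ M) : (jrad Λ M).map C.mkQ = jrad Λ (M ⧸ C) := by
  unfold jrad
  rw [Submodule.map_span]
  congr 1
  ext x
  constructor
  · rintro ⟨_, ⟨a, ha, m, rfl⟩, rfl⟩
    exact ⟨a, ha, C.mkQ m, by simp⟩
  · rintro ⟨a, ha, m, rfl⟩
    obtain ⟨m, rfl⟩ := C.mkQ_surjective m
    exact ⟨a • m, ⟨a, ha, m, rfl⟩, by simp⟩

/-- Let `P` be a finite-dimensional projective `Λ`-module, `C ⊆ JP` a
submodule, and `ρ` the homomorphism sending an automorphism `f` of `P` with `f(C) ⊆ C` to the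
induced automorphism of `P/C`.  The image under `ρ` of
`{f ∈ Aut_Λ(P) : f(C) ⊆ C and (f − id_P)(P) ⊆ JP}` is exactly
`{h ∈ Aut_Λ(P/C) : (h − id)(P/C) ⊆ J·(P/C)}`. -/
theorem stmt13 {K Λ : Type} [Field K] [IsAlgClosed K] [Ring Λ] [Algebra K Λ]
    [FiniteDimensional K Λ]
    (P : Type) [AddCommGroup P] [Module Λ P] [Module K P] [IsScalarTower K Λ P]
    [FiniteDimensional K P]
    (hproj : Module.Projective Λ P)
    (C : Submodule Λ P) (hC : C ≤ jrad Λ P) :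
    ∀ h : (P ⧸ C) ≃ₗ[Λ] (P ⧸ C),
      -- `h` is in the image under `ρ` of the subgroup
      -- `{f : f(C) ⊆ C and (f − id)(P) ⊆ JP}` ...
      ((∃ f : P ≃ₗ[Λ] P, C.map (f : P →ₗ[Λ] P) ≤ C ∧
          (∀ x : P, f x - x ∈ jrad Λ P) ∧
          (∀ x : P, h (Submodule.Quotient.mk x) = Submodule.Quotient.mk (f x)))
      ↔
      -- ... if and only if `(h − id)(P/C) ⊆ J·(P/C)`:
      (∀ y : P ⧸ C, h y - y ∈ jrad Λ (P ⧸ C))) := by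
  intro h
  constructor
  · rintro ⟨f, -, hf, hh⟩ y
    obtain ⟨x, rfl⟩ := C.mkQ_surjective y
    rw [← jrad_map_mk]
    refine ⟨f x - x, hf x, ?_⟩
    rw [map_sub]
    simp only [Submodule.mkQ_apply]
    rw [hh]
  · intro hy
    obtain ⟨g, hg⟩ := Module.projective_lifting_property C.mkQ
      ((h : (P ⧸ C) →ₗ[Λ] (P ⧸ C)) ∘ₗ C.mkQ) C.mkQ_surjective
    have hg' : ∀ x, C.mkQ (g x) = h (C.mkQ x) := fun x => LinearMap.congr_fun hg x
    have hJ : ∀ x, g x - x ∈ jrad Λ P := by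
      intro x
      have h1 := hy (C.mkQ x)
      rw [← hg', ← map_sub, ← jrad_map_mk] at h1
      obtain ⟨z, hz, hzx⟩ := h1
      have h2 : z - (g x - x) ∈ C := (Submodule.Quotient.eq C).1 hzx
      have := (jrad Λ P).sub_mem hz (hC h2)
      rwa [sub_sub_cancel] at this
    have hfin : Module.Finite Λ P := Module.Finite.of_restrictScalars_finite K Λ P
    have hsurj : Function.Surjective g := by
      rw [← LinearMap.range_eq_top]
      by_contra hne
      obtain ⟨N, hN, hle⟩ := (eq_top_or_exists_le_coatom (LinearMap.range g)).resolve_left hne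
      apply hN.1
      rw [eq_top_iff]
      intro x _
      have := N.sub_mem (hle (LinearMap.mem_range_self g x))
        (jrad_le_coatom Λ P N hN (hJ x))
      rwa [sub_sub_cancel] at this
    have hart : IsNoetherian Λ P := isNoetherian_of_tower K inferInstance
    have hinj : Function.Injective g := IsNoetherian.injective_of_surjective_endomorphism g hsurj
    refine ⟨LinearEquiv.ofBijective g ⟨hinj, hsurj⟩, ?_, hJ, fun x => (hg' x).symm⟩
    rintro _ ⟨c, hc, rfl⟩
    have h0 : C.mkQ c = 0 := (Submodule.Quotient.mk_eq_zero C).2 hc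
    have h1 := hg' c
    rw [h0, map_zero] at h1
    exact (Submodule.Quotient.mk_eq_zero C).1 h1
end

section
/- Let P be a finite-dimensional projective Λ-module and C, C' ⊆ JP two Λ-submodules. Then P/C ≅ P/C' as Λ-modules if and only if there exists a Λ-automorphism f of P with f(C) = C'. -/
open Module

/-- Let `P` be a finite-dimensional projective `Λ`-module and
`C, C' ⊆ JP` two submodules.  Then `P/C ≅ P/C'` if and only if some `Λ`-automorphism of `P`
maps `C` onto `C'`. -/
theorem stmt14 {K Λ : Type} [Field K] [IsAlgClosed K] [Ring Λ] [Algebra K Λ]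
    [FiniteDimensional K Λ]
    (P : Type) [AddCommGroup P] [Module Λ P] [Module K P] [IsScalarTower K Λ P]
    [FiniteDimensional K P]
    (hproj : Module.Projective Λ P)
    (C C' : Submodule Λ P) (hC : C ≤ jrad Λ P) (hC' : C' ≤ jrad Λ P) :
    Nonempty ((P ⧸ C) ≃ₗ[Λ] (P ⧸ C')) ↔
      ∃ f : P ≃ₗ[Λ] P, C.map (f : P →ₗ[Λ] P) = C' := by
  have hfin : Module.Finite Λ P := Module.Finite.of_restrictScalars_finite K Λ P
  have : IsNoetherian Λ P := isNoetherian_of_tower K inferInstance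
  have hj : jrad Λ P ≤ Module.jacobson Λ P := by
    unfold jrad
    rw [Submodule.span_le]
    rintro x ⟨a, ha, m, rfl⟩
    rw [jacRad, Ideal.jacobson_bot] at ha
    exact Module.le_comap_jacobson (LinearMap.toSpanSingleton Λ P m) ha
  constructor
  · rintro ⟨e⟩
    obtain ⟨f, hf⟩ := Module.projective_lifting_property C'.mkQ
      ((e : (P ⧸ C) →ₗ[Λ] (P ⧸ C')) ∘ₗ C.mkQ) C'.mkQ_surjective
    have hf' : ∀ p, C'.mkQ (f p) = e (C.mkQ p) := fun p => LinearMap.congr_fun hf p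
    have hsup : LinearMap.range f ⊔ C' = ⊤ := by
      rw [eq_top_iff]
      intro y _
      obtain ⟨p, hp⟩ := C.mkQ_surjective (e.symm (C'.mkQ y))
      have h1 : C'.mkQ (y - f p) = 0 := by
        rw [map_sub, hf', hp, LinearEquiv.apply_symm_apply, sub_self]
      have h2 : y - f p ∈ C' := by
        rwa [← LinearMap.mem_ker, Submodule.ker_mkQ] at h1
      exact Submodule.mem_sup.mpr ⟨f p, ⟨p, rfl⟩, y - f p, h2, by abel⟩
    have hr : LinearMap.range f = ⊤ := by
      rcases eq_top_or_exists_le_coatom (LinearMap.range f) with h | ⟨m, hm, hle⟩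
      · exact h
      · exfalso
        apply hm.1
        rw [eq_top_iff, ← hsup]
        exact sup_le hle ((hC'.trans hj).trans (sInf_le hm))
    have hs : Function.Surjective f := LinearMap.range_eq_top.mp hr
    have hb : Function.Bijective f := IsNoetherian.bijective_of_surjective_endomorphism f hs
    have key : ∀ p, f p ∈ C' ↔ p ∈ C := by
      intro p
      rw [← Submodule.Quotient.mk_eq_zero C', ← Submodule.Quotient.mk_eq_zero C]
      have := hf' p
      simp only [Submodule.mkQ_apply] at this
      rw [this]
      exact e.map_eq_zero_iff
    refine ⟨LinearEquiv.ofBijective f hb, ?_⟩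
    ext y
    constructor
    · rintro ⟨p, hp, rfl⟩
      exact (key p).2 hp
    · intro hy
      obtain ⟨p, rfl⟩ := hs y
      exact ⟨p, (key p).1 hy, rfl⟩
  · rintro ⟨f, hf⟩
    exact ⟨Submodule.Quotient.equiv C C' f hf⟩
end

section
/- Let P = ⊕_{j=1}^t P_j be a direct sum decomposition of a finite-dimensional Λ-module into nonzero submodules, let C ⊆ JP be a Λ-submodule, let {I(1), …, I(s)} be a partition of {1, …, t}, and set Q_i = ⊕_{j ∈ I(i)} P_j. Assume C = ⊕_{i=1}^s (C ∩ Q_i) and that each quotient Q_i/(C ∩ Q_i) is an indecomposable Λ-module. For a = (a_1, …, a_t) ∈ K^t let f_a ∈ End_Λ(P) be the endomorphism acting on P_j as multiplication by a_j. Then f_a(C) ⊆ C if and only if a_j = a_k whenever j and k lie in the same block I(i) of the partition. -/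
open Module

theorem aux_ring_jac (Λ : Type) [Ring Λ] : jacRad Λ = Ring.jacobson Λ := by
  rw [jacRad, Ring.jacobson_eq_sInf_isMaximal, Ideal.jacobson]
  simp

theorem aux_smul_mem {K Λ P : Type} [Field K] [Ring Λ] [Algebra K Λ]
    [AddCommGroup P] [Module Λ P] [Module K P] [IsScalarTower K Λ P]
    (C : Submodule Λ P) (c : K) {x : P} (hx : x ∈ C) : c • x ∈ C := by
  rw [← algebraMap_smul Λ c x]
  exact C.smul_mem _ hx

theorem aux_aeval_mem {K Λ P : Type} [Field K] [Ring Λ] [Algebra K Λ]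
    [AddCommGroup P] [Module Λ P] [Module K P] [IsScalarTower K Λ P]
    [SMulCommClass Λ K P]
    (C : Submodule Λ P) (f : Module.End Λ P) (hf : ∀ x ∈ C, f x ∈ C) (p : Polynomial K) :
    ∀ x ∈ C, (Polynomial.aeval f p) x ∈ C := by
  induction p using Polynomial.induction_on with
  | C a =>
    intro x hx
    simpa [Module.algebraMap_end_apply] using aux_smul_mem C a hx
  | add p q hp hq =>
    intro x hx
    simpa using C.add_mem (hp x hx) (hq x hx)
  | monomial n a h =>
    intro x hx
    have := h (f x) (hf x hx)
    rw [pow_succ, ← mul_assoc, map_mul, Polynomial.aeval_X]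
    exact this

theorem aux_aeval_eig {K Λ P : Type} [Field K] [Ring Λ] [Algebra K Λ]
    [AddCommGroup P] [Module Λ P] [Module K P] [IsScalarTower K Λ P]
    [SMulCommClass Λ K P]
    (f : Module.End Λ P) (c : K) (x : P) (hx : f x = c • x) (p : Polynomial K) :
    (Polynomial.aeval f p) x = p.eval c • x := by
  induction p using Polynomial.induction_on with
  | C a => simp [Module.algebraMap_end_apply]
  | add p q hp hq => simp [hp, hq, add_smul]
  | monomial n a h =>
    rw [pow_succ, ← mul_assoc, map_mul, Polynomial.aeval_X, Module.End.mul_apply, hx]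
    rw [← algebraMap_smul Λ c x, map_smul, h, algebraMap_smul, smul_smul, mul_comm,
      Polynomial.eval_mul_X]

theorem aux_not_le {K Λ : Type} [Field K] [Ring Λ] [Algebra K Λ]
    (P : Type) [AddCommGroup P] [Module Λ P] [Module K P] [IsScalarTower K Λ P]
    [FiniteDimensional K P]
    (t : ℕ) (Pj : Fin t → Submodule Λ P)
    (hindep : iSupIndep Pj) (hsum : (⨆ j, Pj j) = ⊤) (hne : ∀ j, Pj j ≠ ⊥) (j : Fin t) :
    ¬ Pj j ≤ jrad Λ P := by
  intro h
  have hc : IsCompl (Pj j) (⨆ i, ⨆ (_ : i ≠ j), Pj i) := by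
    refine ⟨hindep j, ?_⟩
    rw [codisjoint_iff, eq_top_iff, ← hsum]
    refine iSup_le fun i => ?_
    by_cases hij : i = j
    · subst hij; exact le_sup_left
    · exact le_trans (le_iSup₂_of_le i hij le_rfl) le_sup_right
  have hle : jrad Λ P ≤ (Ring.jacobson Λ • Pj j).comap ((Pj j).projection _ hc) := by
    refine Submodule.span_le.2 ?_
    rintro x ⟨a, ha, m, rfl⟩
    rw [aux_ring_jac] at ha
    simp only [SetLike.mem_coe, Submodule.mem_comap, map_smul]
    exact Submodule.smul_mem_smul ha (Submodule.projection_apply_mem hc m)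
  have : IsNoetherian K P := inferInstance
  have : IsNoetherian Λ P := isNoetherian_of_tower K this
  refine hne j (Submodule.FG.eq_bot_of_le_jacobson_smul (IsNoetherian.noetherian _) ?_)
  intro x hx
  have := hle (h hx)
  rwa [Submodule.mem_comap, Submodule.projection_apply_of_mem_left hc hx] at this

/-- Let `P = ⊕_{j} P_j` be a direct sum decomposition of a
finite-dimensional module into nonzero submodules, `C ⊆ JP` a submodule, `blk` a partition of
the index set into `s` blocks with `Q_i = ⊕_{blk j = i} P_j`, and assume `C = ⊕_i (C ∩ Q_i)`
with each `Q_i/(C ∩ Q_i)` indecomposable.  For `a ∈ K^t` let `f_a` be the endomorphism of `P`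
acting on `P_j` as multiplication by `a_j`.  Then `f_a(C) ⊆ C` iff `a_j = a_k` whenever `j`
and `k` lie in the same block. -/
theorem stmt15 {K Λ : Type} [Field K] [IsAlgClosed K] [Ring Λ] [Algebra K Λ]
    [FiniteDimensional K Λ]
    (P : Type) [AddCommGroup P] [Module Λ P] [Module K P] [IsScalarTower K Λ P]
    [SMulCommClass Λ K P] [FiniteDimensional K P]
    -- the internal direct sum decomposition `P = ⊕_{j=1}^t P_j` into nonzero submodules:
    (t : ℕ) (Pj : Fin t → Submodule Λ P)
    (hindep : iSupIndep Pj) (hsum : (⨆ j, Pj j) = ⊤) (hne : ∀ j, Pj j ≠ ⊥)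
    (C : Submodule Λ P) (hC : C ≤ jrad Λ P)
    -- the partition `{I(1), …, I(s)}` of `{1, …, t}`, given by the fibres of `blk`,
    -- and `Q_i = ⊕_{j ∈ I(i)} P_j`:
    (s : ℕ) (blk : Fin t → Fin s) (hblk : Function.Surjective blk)
    (Q : Fin s → Submodule Λ P) (hQ : ∀ i, Q i = ⨆ j ∈ {j | blk j = i}, Pj j)
    -- `C = ⊕_{i=1}^s (C ∩ Q_i)`:
    (hCdec : C = ⨆ i, C ⊓ Q i)
    -- each `Q_i / (C ∩ Q_i)` is indecomposable:
    (hindec : ∀ i,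
      (⊥ : Submodule Λ (↥(Q i) ⧸ Submodule.comap (Q i).subtype (C ⊓ Q i))) ≠ ⊤ ∧
      ∀ A B : Submodule Λ (↥(Q i) ⧸ Submodule.comap (Q i).subtype (C ⊓ Q i)),
        A ⊓ B = ⊥ → A ⊔ B = ⊤ → A = ⊥ ∨ B = ⊥)
    -- `f = f_a` is the endomorphism of `P` acting on `P_j` as multiplication by `a j`:
    (a : Fin t → K) (f : P →ₗ[Λ] P) (hf : ∀ j, ∀ x ∈ Pj j, f x = a j • x) :
    C.map f ≤ C ↔ ∀ j k, blk j = blk k → a j = a k := by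
  classical
  constructor
  · intro hfC j k hjk
    by_contra hne'
    have hfC' : ∀ x ∈ C, f x ∈ C := fun x hx => hfC (Submodule.mem_map_of_mem hx)
    obtain ⟨p, hp⟩ : ∃ p : Polynomial K, ∀ l, p.eval (a l) = if a l = a j then 1 else 0 := by
      rw [Polynomial.exists_eval_eq_iff]
      intro l m h
      simp [h]
    obtain ⟨e, he⟩ : ∃ e : P →ₗ[Λ] P, e = Polynomial.aeval (R := K) (A := Module.End Λ P) f p :=
      ⟨_, rfl⟩
    have heP : ∀ l, ∀ x ∈ Pj l, e x = if a l = a j then x else 0 := by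
      intro l x hx
      rw [he, aux_aeval_eig f (a l) x (hf l x hx), hp]
      split_ifs <;> simp
    have heC : ∀ x ∈ C, e x ∈ C := by
      rw [he]; exact aux_aeval_mem C f hfC' p
    have hle : ∀ l, Pj l ≤ Q (blk l) := by
      intro l
      rw [hQ]
      exact le_iSup₂_of_le (f := fun j (_ : j ∈ {j | blk j = blk l}) => Pj j) l rfl le_rfl
    have heQ : ∀ i, ∀ x ∈ Q i, e x ∈ Q i := by
      intro i
      suffices h : Q i ≤ (Q i).comap e from fun x hx => h hx
      conv_lhs => rw [hQ]
      refine iSup₂_le fun l hl x hx => ?_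
      have hl' : blk l = i := hl
      rw [Submodule.mem_comap, heP l x hx]
      split_ifs
      · exact hl' ▸ hle l hx
      · exact Submodule.zero_mem _
    have hidem : ∀ x, e (e x) = e x := by
      intro x
      have h : (⊤ : Submodule Λ P) ≤ LinearMap.ker (e ∘ₗ e - e) := by
        rw [← hsum]
        refine iSup_le fun l x hx => ?_
        rw [LinearMap.mem_ker, LinearMap.sub_apply, LinearMap.comp_apply, heP l x hx]
        split_ifs with h
        · rw [heP l x hx, if_pos h, sub_self]
        · simp
      have := h (Submodule.mem_top (x := x))
      simpa [sub_eq_zero] using this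
    let i := blk j
    let N := Submodule.comap (Q i).subtype (C ⊓ Q i)
    let A := (Submodule.comap (Q i).subtype (LinearMap.ker (e - LinearMap.id))).map N.mkQ
    let B := (Submodule.comap (Q i).subtype (LinearMap.ker e)).map N.mkQ
    have hAB : A ⊓ B = ⊥ := by
      rw [eq_bot_iff]
      rintro z ⟨⟨x, hx, rfl⟩, ⟨y, hy, hxy⟩⟩
      have hx' : e x = x := by simpa [sub_eq_zero] using hx
      have hy' : e y = 0 := by simpa using hy
      have h1 : y - x ∈ N := (Submodule.Quotient.eq N).1 hxy
      have h2 : ((y : P) - x) ∈ C := h1.1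
      have h3 := heC _ h2
      rw [map_sub, hx', hy', zero_sub, C.neg_mem_iff] at h3
      rw [Submodule.mem_bot, Submodule.mkQ_apply, Submodule.Quotient.mk_eq_zero]
      exact ⟨h3, x.2⟩
    have hABt : A ⊔ B = ⊤ := by
      rw [eq_top_iff]
      rintro z -
      obtain ⟨x, rfl⟩ := N.mkQ_surjective z
      have hx : x = ⟨e x, heQ i x x.2⟩ + (x - ⟨e x, heQ i x x.2⟩) := by abel
      rw [hx, map_add]
      refine Submodule.add_mem_sup (Submodule.mem_map_of_mem ?_) (Submodule.mem_map_of_mem ?_)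
      · simp [hidem]
      · simp [hidem]
    have key : ∀ l, blk l = i → ∀ D : Submodule Λ P, Pj l ≤ D →
        (Submodule.comap (Q i).subtype D).map N.mkQ = ⊥ → False := by
      intro l hl D hD hbot
      refine aux_not_le (K := K) P t Pj hindep hsum hne l (le_trans ?_ hC)
      intro x hx
      have hxQ : x ∈ Q i := hl ▸ hle l hx
      have h1 : N.mkQ ⟨x, hxQ⟩ ∈ (Submodule.comap (Q i).subtype D).map N.mkQ :=
        Submodule.mem_map_of_mem (hD hx)
      rw [hbot, Submodule.mem_bot, Submodule.mkQ_apply, Submodule.Quotient.mk_eq_zero] at h1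
      exact h1.1
    rcases (hindec i).2 A B hAB hABt with h | h
    · refine key j rfl _ ?_ h
      intro x hx
      simp [heP j x hx]
    · refine key k hjk.symm _ ?_ h
      intro x hx
      rw [LinearMap.mem_ker, heP k x hx, if_neg (Ne.symm hne')]
  · intro h
    rw [Submodule.map_le_iff_le_comap]
    conv_lhs => rw [hCdec]
    refine iSup_le fun i x hx => ?_
    obtain ⟨j, rfl⟩ := hblk i
    have hs : ∀ x ∈ Q (blk j), f x = a j • x := by
      intro x hx
      rw [hQ] at hx
      have hle : (⨆ l ∈ {l | blk l = blk j}, Pj l) ≤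
          LinearMap.ker ((f : Module.End Λ P) - algebraMap K (Module.End Λ P) (a j)) := by
        refine iSup₂_le fun l hl y hy => ?_
        have : a l = a j := h l j hl
        simp [hf l y hy, this, Module.algebraMap_end_apply]
      have := hle hx
      simpa [sub_eq_zero, Module.algebraMap_end_apply] using this
    rw [Submodule.mem_comap, hs x hx.2]
    exact aux_smul_mem C _ hx.1
end
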